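/- arXiv:math/0409501 — 2 statements merged into one kernel-verified Lean document; each statement's English description precedes it below -/
import Mathlib

section
/- For every ε > 0 there exists a constant c > 0 (depending on ε, ineffective) such that for every squarefree integer d < 0, the class number h of K = ℚ(√d) satisfies h ≥ c·|disc(K)|^{1/2 − ε}. -/
open Complex Metric in
open scoped ComplexOrder in
theorem sg_lemmaG0 : ∃ C0 : ℝ, 1 ≤ C0 ∧ ∀ (a : ℕ → ℂ) (G : ℂ → ℂ) (M lam : ℝ),
    (∀ n, ∃ r : ℝ, 0 ≤ r ∧ a n = r) → a 1 = 1 → (∀ s : ℂ, 1 < s.re → LSeriesSummable a s) →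
    (∀ s : ℂ, 1 < s.re → LSeries a s = riemannZeta s * G s) →
    DifferentiableOn ℂ G {s | 0 < s.re} →
    (∀ s ∈ closedBall (2 : ℂ) (4/3), ‖G s‖ ≤ M) → G 1 = lam →
    ∀ β : ℝ, 7/8 ≤ β → β < 1 → ∀ N : ℕ, N ≠ 0 → C0 * M * (27/32)^N ≤ 1/2 →
    1/2 - lam * (2 - β)^N / (1 - β) ≤ (riemannZeta β * G β).re := by
  set Z : ℂ → ℂ := DirichletCharacter.LFunctionTrivChar₁ 1 with hZ
  have hZd : Differentiable ℂ Z := DirichletCharacter.differentiable_LFunctionTrivChar₁ 1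
  have hZ1 : Z 1 = 1 := by simp [hZ, DirichletCharacter.LFunctionTrivChar₁]
  have hZs : ∀ s, s ≠ 1 → Z s = (s - 1) * riemannZeta s := by
    intro s hs
    simp [hZ, DirichletCharacter.LFunctionTrivChar₁, Function.update_of_ne hs,
      DirichletCharacter.LFunctionTrivChar, DirichletCharacter.LFunction_modOne_eq]
  obtain ⟨CZ, hCZ⟩ := (isCompact_closedBall (2 : ℂ) (4/3)).exists_bound_of_continuousOn
    hZd.continuous.continuousOn
  have hCZ0 : 0 ≤ CZ := (norm_nonneg _).trans (hCZ 2 (by simp; norm_num))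
  refine ⟨32/5 * (3 * (CZ + 1)) , by nlinarith, ?_⟩
  intro a G M lam ha ha1 hsum hL hG hM hG1 β hβ hβ1 N hN0 hN
  have h1mem : (1 : ℂ) ∈ closedBall (2 : ℂ) (4/3) := by
    rw [mem_closedBall, dist_eq]; norm_num
  have hM0 : 0 ≤ M := (norm_nonneg _).trans (hM 1 h1mem)
  set W : ℂ → ℂ := fun s ↦ Z s * G s with hW
  set U : Set ℂ := {s | 0 < s.re} with hU
  have hUo : IsOpen U := continuous_re.isOpen_preimage _ isOpen_Ioi
  have hball : closedBall (2 : ℂ) (4/3) ⊆ U := by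
    intro s hs
    rw [mem_closedBall, dist_eq] at hs
    have := (abs_le.mp ((abs_re_le_norm (s - 2)).trans hs)).1
    simp only [sub_re, re_ofNat] at this
    change 0 < s.re
    linarith
  set H : ℂ → ℂ := dslope W 1 with hH
  have hHd : DifferentiableOn ℂ H U := by
    rw [hH, Complex.differentiableOn_dslope (hUo.mem_nhds (by simp [hU]))]
    exact hZd.differentiableOn.mul hG
  have hW1 : W 1 = lam := by simp [hW, hZ1, hG1]
  have hHs : ∀ s, s ≠ 1 → H s = riemannZeta s * G s - lam * (s - 1)⁻¹ := by
    intro s hs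
    have : s - 1 ≠ 0 := sub_ne_zero.mpr hs
    rw [hH, dslope_of_ne _ hs, slope_def_field, hW1, hW]
    simp only [hZs s hs]
    field_simp
  have hHb : ∀ s ∈ sphere (2 : ℂ) (4/3), ‖H s‖ ≤ 3 * (CZ + 1) * M := by
    intro s hs
    have hs' := sphere_subset_closedBall hs
    rw [mem_sphere, dist_eq] at hs
    have h3 : (1/3 : ℝ) ≤ ‖s - 1‖ := by
      have := norm_sub_norm_le (s - 2) (-1)
      rw [hs] at this
      have e : s - 2 - -1 = s - 1 := by ring
      rw [e] at this
      norm_num at this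
      linarith
    have hs1 : s ≠ 1 := by
      rintro rfl
      norm_num at h3
    rw [hH, dslope_of_ne _ hs1, slope_def_field, norm_div, div_le_iff₀ (by linarith), hW1]
    have b1 : ‖W s‖ ≤ CZ * M := by
      rw [hW]; simp only [norm_mul]
      exact mul_le_mul (hCZ s hs') (hM s hs') (norm_nonneg _) hCZ0
    have b2 : ‖(lam : ℂ)‖ ≤ M := by rw [← hG1]; exact hM 1 h1mem
    have b3 := norm_sub_le (W s) lam
    nlinarith [mul_nonneg hCZ0 hM0]
  have hcau : ∀ n : ℕ, ‖iteratedDeriv n H 2‖ ≤ n.factorial * (3 * (CZ + 1) * M) / (4/3)^n := by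
    intro n
    apply norm_iteratedDeriv_le_of_forall_mem_sphere_norm_le n (by norm_num) _ hHb
    apply DifferentiableOn.diffContOnCl
    rw [closure_ball _ (by norm_num)]
    exact hHd.mono hball
  have hβmem : (β : ℂ) ∈ ball (2 : ℂ) (4/3) := by
    rw [mem_ball, dist_eq, show (β : ℂ) - 2 = ((β - 2 : ℝ) : ℂ) by push_cast; ring,
      Complex.norm_real, Real.norm_eq_abs, abs_lt]
    constructor <;> linarith
  have hts := hasSum_taylorSeries_on_ball (hHd.mono (ball_subset_closedBall.trans hball)) hβmem
  -- coefficients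
  have habs : LSeries.abscissaOfAbsConv a < (2 : ℝ) := by
    refine lt_of_le_of_lt (LSeries.abscissaOfAbsConv_le_of_forall_lt_LSeriesSummable' (x := 1)
      fun y hy ↦ hsum y ?_) ?_
    · simpa using (by exact_mod_cast hy : (1:ℝ) < y)
    · exact_mod_cast one_lt_two
  have hnon : (0 : ℕ → ℂ) ≤ a := by
    intro n
    obtain ⟨r, hr, e⟩ := ha n
    simp [e, hr]
  have hb := fun n ↦ LSeries.iteratedDeriv_alternating hnon habs n
  have hinv : ∀ n : ℕ, iteratedDeriv n (fun s : ℂ ↦ (s - 1)⁻¹) 2 = (-1)^n * n.factorial := by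
    intro n
    have := iteratedDeriv_comp_sub_const n (fun s : ℂ ↦ s⁻¹) 1
    rw [this]
    simp only
    rw [iteratedDeriv_eq_iterate, iter_deriv_inv]
    norm_num
  have hderiv : ∀ n : ℕ, iteratedDeriv n H 2 =
      iteratedDeriv n (LSeries a) 2 - lam * ((-1)^n * n.factorial) := by
    intro n
    have hV : IsOpen {s : ℂ | 1 < s.re} := continuous_re.isOpen_preimage _ isOpen_Ioi
    have h2V : (2 : ℂ) ∈ {s : ℂ | 1 < s.re} := by simp
    have e1 : Set.EqOn H (fun s ↦ LSeries a s - lam * (s - 1)⁻¹) {s : ℂ | 1 < s.re} := by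
      intro s hs
      have hs' : 1 < s.re := hs
      simp only
      rw [hHs s (by rintro rfl; simp at hs'), hL s hs]
    rw [e1.iteratedDeriv_of_isOpen hV n h2V]
    have hcL : ContDiffAt ℂ n (LSeries a) 2 := by
      have : AnalyticAt ℂ (LSeries a) 2 := LSeries_analyticOnNhd a 2 (by simpa using habs)
      exact this.contDiffAt
    have hcI : ContDiffAt ℂ n (fun s : ℂ ↦ (s - 1)⁻¹) 2 := by
      apply ContDiffAt.inv
      · fun_prop
      · norm_num
    rw [iteratedDeriv_fun_sub hcL (contDiffAt_const.mul hcI), iteratedDeriv_const_mul_field, hinv]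
  set b : ℕ → ℝ := fun n ↦ ((-1)^n * iteratedDeriv n (LSeries a) 2).re / n.factorial with hbdef
  have hbnn : ∀ n, 0 ≤ b n := fun n ↦ div_nonneg (by
    have := hb n
    rw [Complex.le_def] at this
    simpa using this.1) (by positivity)
  have hbc : ∀ n, iteratedDeriv n (LSeries a) 2 = (-1)^n * n.factorial * b n := by
    intro n
    have h0 := hb n
    rw [Complex.le_def] at h0
    have e : ((-1)^n * iteratedDeriv n (LSeries a) 2) =
      (((-1)^n * iteratedDeriv n (LSeries a) 2).re : ℂ) := by
      apply Complex.ext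
      · simp
      · simpa using h0.2.symm
    have hf : (n.factorial : ℂ) ≠ 0 := by exact_mod_cast n.factorial_ne_zero
    have : (n.factorial : ℂ) * b n = (-1)^n * iteratedDeriv n (LSeries a) 2 := by
      rw [e, hbdef]; push_cast; field_simp
    rw [mul_assoc, this, ← mul_assoc, ← mul_pow]; simp
  have hb0 : 1 ≤ b 0 := by
    have e : b 0 = (LSeries a 2).re := by simp [hbdef]
    rw [e, LSeries]
    have hs2 := hsum 2 (by simp)
    rw [Complex.re_tsum hs2]
    have hterm : ∀ n, 0 ≤ (LSeries.term a 2 n).re := fun n ↦ by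
      have := LSeries.term_nonneg (hnon n) 2
      rw [Complex.le_def] at this
      simpa using this.1
    refine le_trans ?_ ((Complex.reCLM.summable hs2).le_tsum 1 fun n _ ↦ hterm n)
    simp [LSeries.term, ha1]
  have hts2 : HasSum (fun n : ℕ ↦ (b n - lam) * (2 - β)^n) (H β).re := by
    have := Complex.reCLM.hasSum hts
    refine this.congr_fun ?_ |> fun h ↦ h
    intro n
    have hf : (n.factorial : ℂ) ≠ 0 := by exact_mod_cast n.factorial_ne_zero
    have : ((n.factorial : ℂ)⁻¹ • ((β : ℂ) - 2) ^ n • iteratedDeriv n H 2) =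
        (((b n - lam) * (2 - β)^n : ℝ) : ℂ) := by
      rw [hderiv, hbc]
      simp only [smul_eq_mul]
      push_cast
      have : ((2 : ℂ) - β)^n = (-1)^n * (β - 2)^n := by rw [← mul_pow]; congr 1; ring
      rw [this]; field_simp
    change _ = Complex.re _
    rw [this, ofReal_re]
  have hbd : ∀ n, |(b n - lam) * (2 - β)^n| ≤ 3 * (CZ + 1) * M * (27/32)^n := by
    intro n
    have h1 := hcau n
    rw [hderiv, hbc] at h1
    have hf : (0 : ℝ) < n.factorial := by exact_mod_cast n.factorial_pos
    have e : ((-1)^n * n.factorial * b n - lam * ((-1)^n * n.factorial) : ℂ) =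
      (-1)^n * (((n.factorial * (b n - lam) : ℝ)) : ℂ) := by push_cast; ring
    rw [e, norm_mul, norm_pow, norm_neg, norm_one, one_pow, one_mul, Complex.norm_real,
      Real.norm_eq_abs, abs_mul, abs_of_pos hf, mul_div_assoc] at h1
    have h2 := le_of_mul_le_mul_left h1 hf
    rw [abs_mul, abs_of_nonneg (pow_nonneg (by linarith) n : 0 ≤ (2 - β)^n)]
    have h3 : (2 - β)^n ≤ (9/8)^n := pow_le_pow_left₀ (by linarith) (by linarith) n
    calc _ ≤ (3 * (CZ + 1) * M / (4/3)^n) * (9/8)^n :=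
          mul_le_mul h2 h3 (pow_nonneg (by linarith) n) (by positivity)
      _ = _ := by
          rw [div_mul_eq_mul_div, mul_div_assoc, ← div_pow]; norm_num
  have hsplit := hts2.summable.sum_add_tsum_nat_add N
  rw [hts2.tsum_eq] at hsplit
  have hgeo : HasSum (fun n : ℕ ↦ 3 * (CZ + 1) * M * (27/32)^(n + N) : ℕ → ℝ)
      (32/5 * (3 * (CZ + 1)) * M * (27/32)^N) := by
    have := (hasSum_geometric_of_lt_one (r := (27/32 : ℝ)) (by norm_num) (by norm_num)).mul_left
      (3 * (CZ + 1) * M * (27/32)^N)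
    have e1 : (fun n : ℕ ↦ 3 * (CZ + 1) * M * (27/32)^(n + N) : ℕ → ℝ) =
        fun i ↦ 3 * (CZ + 1) * M * (27 / 32) ^ N * (27 / 32) ^ i := by
      funext n; rw [pow_add]; ring
    have e2 : 32/5 * (3 * (CZ + 1)) * M * (27/32)^N =
      3 * (CZ + 1) * M * (27 / 32) ^ N * (1 - 27 / 32 : ℝ)⁻¹ := by
      rw [show (1 - 27 / 32 : ℝ)⁻¹ = 32/5 by norm_num]; ring
    rw [e1, e2]; exact this
  have htail : |∑' n, (b (n + N) - lam) * (2 - β)^(n + N)| ≤ 1/2 := by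
    refine le_trans ?_ hN
    have := tsum_of_norm_bounded hgeo (f := fun n ↦ (b (n + N) - lam) * (2 - β)^(n + N))
      fun n ↦ hbd (n + N)
    simpa using this
  have hhead : 1 - lam * (((2 - β)^N - 1) / (1 - β)) ≤
      ∑ n ∈ Finset.range N, (b n - lam) * (2 - β)^n := by
    have hgs : ∑ n ∈ Finset.range N, (2 - β)^n = ((2 - β)^N - 1) / (1 - β) := by
      rw [geom_sum_eq (by linarith)]; congr 1; ring
    rw [← hgs, Finset.mul_sum]
    simp only [sub_mul, Finset.sum_sub_distrib]
    gcongr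
    calc (1 : ℝ) ≤ b 0 * (2 - β)^0 := by simpa using hb0
      _ ≤ _ := Finset.single_le_sum (f := fun n ↦ b n * (2 - β)^n)
          (fun n _ ↦ mul_nonneg (hbnn n) (pow_nonneg (by linarith) n))
          (Finset.mem_range.mpr (Nat.pos_of_ne_zero hN0))
  have hHβ : (H β).re = (riemannZeta β * G β).re + lam / (1 - β) := by
    rw [hHs _ (by intro h; have : β = 1 := by exact_mod_cast h
                  linarith), sub_re]
    have : (lam : ℂ) * ((β : ℂ) - 1)⁻¹ = ((lam * (β - 1)⁻¹ : ℝ) : ℂ) := by push_cast; ring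
    rw [this, ofReal_re, ← neg_sub 1 β, inv_neg]
    ring
  have hlow := (abs_le.mp htail).1
  have h1β : 1 - β ≠ 0 := by linarith
  have e1 : lam * (((2 - β)^N - 1) / (1 - β)) = lam * (2 - β)^N / (1 - β) - lam / (1 - β) := by
    field_simp
  rw [e1] at hhead
  linarith

open Complex Metric in
theorem sg_lemmaG : ∃ A C1 : ℝ, 0 < A ∧ 0 < C1 ∧ ∀ (a : ℕ → ℂ) (G : ℂ → ℂ) (M lam : ℝ),
    (∀ n, ∃ r : ℝ, 0 ≤ r ∧ a n = r) → a 1 = 1 → (∀ s : ℂ, 1 < s.re → LSeriesSummable a s) →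
    (∀ s : ℂ, 1 < s.re → LSeries a s = riemannZeta s * G s) →
    DifferentiableOn ℂ G {s | 0 < s.re} →
    (∀ s ∈ closedBall (2 : ℂ) (4/3), ‖G s‖ ≤ M) → G 1 = lam → 1 ≤ M →
    ∀ β : ℝ, 7/8 ≤ β → β < 1 → (riemannZeta β * G β).re ≤ 0 →
    (1 - β) * C1 * M ^ (-(A * (1 - β))) ≤ lam := by
  obtain ⟨C0, hC0, key⟩ := sg_lemmaG0
  set l : ℝ := Real.log (32/27) with hl
  have hlpos : 0 < l := Real.log_pos (by norm_num)
  refine ⟨1/l, 1 / (2 * Real.exp 1 * (2*C0)^(1/l)), by positivity, by positivity, ?_⟩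
  intro a G M lam ha ha1 hsum hL hG hM hG1 hM1 β hβ hβ1 hF
  have hx : 1 < 2 * C0 * M := by nlinarith
  have hlx : 0 < Real.log (2 * C0 * M) := Real.log_pos hx
  set N : ℕ := ⌈Real.log (2 * C0 * M) / l⌉₊ with hN
  have hNpos : 0 < N := Nat.ceil_pos.mpr (by positivity)
  have hNle : Real.log (2 * C0 * M) / l ≤ N := Nat.le_ceil _
  have hNlt : (N : ℝ) < Real.log (2 * C0 * M) / l + 1 := Nat.ceil_lt_add_one (by positivity)
  have hpow : C0 * M * (27/32)^N ≤ 1/2 := by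
    have h1 : (2 * C0 * M) ≤ (32/27 : ℝ)^N := by
      rw [← Real.log_le_log_iff (by linarith) (by positivity), Real.log_pow]
      rwa [div_le_iff₀ hlpos] at hNle
    have h2 : (32/27 : ℝ)^N * (27/32)^N = 1 := by rw [← mul_pow]; norm_num
    have h3 : (0 : ℝ) < (27/32)^N := by positivity
    nlinarith
  have h := key a G M lam ha ha1 hsum hL hG hM hG1 β hβ hβ1 N hNpos.ne' hpow
  have hpos : 0 < 1 - β := by linarith
  have h1 : 1/2 ≤ lam * (2 - β)^N / (1 - β) := by linarith
  rw [le_div_iff₀ hpos] at h1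
  have hE : (2 - β)^N ≤ Real.exp 1 * (2*C0)^(1/l) * M ^ (1/l * (1 - β)) := by
    have e0 : (2 - β) ≤ Real.exp (1 - β) := by linarith [Real.add_one_le_exp (1 - β)]
    calc (2 - β)^N ≤ (Real.exp (1 - β))^N := pow_le_pow_left₀ (by linarith) e0 N
      _ = Real.exp ((1 - β) * N) := by rw [← Real.exp_nat_mul]; ring_nf
      _ ≤ Real.exp (1 + (1/l * Real.log (2 * C0) + Real.log M * (1/l * (1 - β)))) := by
        apply Real.exp_le_exp.mpr
        rw [Real.log_mul (by linarith) (by linarith)] at hNlt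
        have hc : 0 ≤ Real.log (2 * C0) := Real.log_nonneg (by linarith)
        have hc2 : 0 ≤ Real.log (2 * C0) / l := by positivity
        calc (1 - β) * N ≤ (1 - β) * ((Real.log (2 * C0) + Real.log M) / l + 1) := by gcongr
          _ = (1 - β) + (1 - β) * (Real.log (2 * C0) / l) + Real.log M * (1/l * (1 - β)) := by
            field_simp; ring
          _ ≤ 1 + 1 * (Real.log (2 * C0) / l) + Real.log M * (1/l * (1 - β)) := by
            gcongr <;> linarith
          _ = _ := by ring
      _ = _ := by
        rw [Real.exp_add, Real.exp_add, Real.rpow_def_of_pos (by linarith),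
          Real.rpow_def_of_pos (by linarith)]
        ring_nf
  have hlam : 0 < lam := by
    by_contra hneg
    push Not at hneg
    have : lam * (2 - β)^N ≤ 0 := mul_nonpos_of_nonpos_of_nonneg hneg (pow_nonneg (by linarith) N)
    linarith
  set D := Real.exp 1 * (2*C0)^(1/l) with hD
  have hDpos : 0 < D := by positivity
  have hMp : 0 < M ^ (1/l * (1 - β)) := by positivity
  have h2 : 1/2 * (1 - β) ≤ lam * (D * M ^ (1/l * (1 - β))) :=
    h1.trans (mul_le_mul_of_nonneg_left hE hlam.le)
  rw [Real.rpow_neg (by linarith)]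
  have : (1 - β) * (1 / (2 * Real.exp 1 * (2 * C0) ^ (1 / l))) * (M ^ (1 / l * (1 - β)))⁻¹
    = (1/2 * (1 - β)) / (D * M ^ (1/l * (1 - β))) := by
    rw [hD]; field_simp
  rw [this, div_le_iff₀ (by positivity)]
  exact h2


structure SgChar (χ : ℕ → ℝ) (q : ℝ) : Prop where
  zero : χ 0 = 0
  one : χ 1 = 1
  mul : ∀ m n, χ (m * n) = χ m * χ n
  val : ∀ n, χ n = -1 ∨ χ n = 0 ∨ χ n = 1
  hq : 1 ≤ q
  bound : ∀ N : ℕ, |∑ k ∈ Finset.Icc 1 N, χ k| ≤ q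

noncomputable def sgS (χ : ℕ → ℝ) (t : ℝ) : ℝ := ∑ k ∈ Finset.Icc 1 ⌊t⌋₊, χ k

noncomputable def sgL (χ : ℕ → ℝ) (s : ℂ) : ℂ := s * mellin (fun t ↦ (sgS χ t : ℂ)) (-s)

theorem SgChar.abs_le {χ : ℕ → ℝ} {q : ℝ} (h : SgChar χ q) (n : ℕ) : |χ n| ≤ 1 := by
  rcases h.val n with e | e | e <;> simp [e]

theorem sgS_zero {χ : ℕ → ℝ} {t : ℝ} (ht : t < 1) : sgS χ t = 0 := by
  simp [sgS, Nat.floor_eq_zero.mpr ht]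

theorem SgChar.S_le {χ : ℕ → ℝ} {q : ℝ} (h : SgChar χ q) (t : ℝ) : |sgS χ t| ≤ q := h.bound _

theorem SgChar.S_le' {χ : ℕ → ℝ} {q : ℝ} (h : SgChar χ q) {t : ℝ} (ht : 0 ≤ t) : |sgS χ t| ≤ t := by
  refine (Finset.abs_sum_le_sum_abs _ _).trans ?_
  refine (Finset.sum_le_sum fun k _ ↦ h.abs_le k).trans ?_
  simpa using Nat.floor_le ht

theorem sgS_meas (χ : ℕ → ℝ) : Measurable (sgS χ) := by
  have : sgS χ = (fun n : ℕ ↦ ∑ k ∈ Finset.Icc 1 n, χ k) ∘ (fun t : ℝ ↦ ⌊t⌋₊) := rfl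
  rw [this]
  exact (measurable_from_nat).comp Nat.measurable_floor

open MeasureTheory Asymptotics Filter Set in
theorem SgChar.diff {χ : ℕ → ℝ} {q : ℝ} (h : SgChar χ q) :
    DifferentiableOn ℂ (sgL χ) {s | 0 < s.re} := by
  intro s hs
  have hs : 0 < s.re := hs
  apply DifferentiableAt.differentiableWithinAt
  unfold sgL
  apply differentiableAt_id.mul
  have hm : DifferentiableAt ℂ (mellin (fun t ↦ (sgS χ t : ℂ))) (-s) := by
    apply mellin_differentiableAt_of_isBigO_rpow (a := 0) (b := -s.re - 1)
    · apply LocallyIntegrable.locallyIntegrableOn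
      refine (locallyIntegrable_const q).mono ?_ ?_
      · exact (Complex.measurable_ofReal.comp (sgS_meas χ)).aestronglyMeasurable
      · refine Eventually.of_forall fun t ↦ ?_
        rw [Complex.norm_real, Real.norm_eq_abs, Real.norm_eq_abs]
        exact (h.S_le t).trans (le_abs_self q)
    · refine IsBigO.of_bound q (Eventually.of_forall fun t ↦ ?_)
      simpa using h.S_le t
    · simpa using hs
    · refine IsBigO.of_bound 1 ?_
      filter_upwards [mem_nhdsWithin_of_mem_nhds (Iio_mem_nhds one_pos)] with t ht
      rw [sgS_zero ht]; simp
    · simp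
  exact hm.comp s differentiableAt_id.neg

theorem SgChar.summable {χ : ℕ → ℝ} {q : ℝ} (h : SgChar χ q) {s : ℂ} (hs : 1 < s.re) :
    LSeriesSummable (fun n ↦ (χ n : ℂ)) s :=
  LSeriesSummable_of_bounded_of_one_lt_re (m := 1)
    (fun n _ ↦ by simpa using h.abs_le n) hs

theorem sgL_eq_int (χ : ℕ → ℝ) (s : ℂ) : sgL χ s =
    s * ∫ t in Set.Ioi (1 : ℝ), (t : ℂ) ^ (-s - 1) * (sgS χ t : ℂ) := by
  unfold sgL mellin
  congr 1
  simp only [smul_eq_mul]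
  symm
  have hsub : Set.Ici (1:ℝ) ⊆ Set.Ioi 0 := fun t ht ↦ by
    have h1 : (1:ℝ) ≤ t := ht
    exact (by linarith : (0:ℝ) < t)
  rw [← MeasureTheory.integral_Ici_eq_integral_Ioi]
  symm
  refine MeasureTheory.setIntegral_eq_of_subset_of_forall_sdiff_eq_zero measurableSet_Ioi hsub ?_
  intro t ht
  have : t < 1 := not_le.mp ht.2
  rw [sgS_zero this]; simp

theorem SgChar.eq {χ : ℕ → ℝ} {q : ℝ} (h : SgChar χ q) {s : ℂ} (hs : 1 < s.re) :
    LSeries (fun n ↦ (χ n : ℂ)) s = sgL χ s := by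
  rw [LSeries_eq_mul_integral _ (r := 0) le_rfl (by linarith) (h.summable hs), sgL_eq_int]
  · congr 1
    apply MeasureTheory.integral_congr_ae
    refine Filter.Eventually.of_forall fun t ↦ ?_
    simp only [sgS]
    push_cast
    rw [mul_comm, neg_add']
  · refine Asymptotics.IsBigO.of_bound q (Filter.Eventually.of_forall fun n ↦ ?_)
    have := h.bound n
    rw [← Complex.ofReal_sum, Complex.norm_real, Real.norm_eq_abs]
    simpa only [Real.rpow_zero, norm_one, mul_one] using this

theorem sgL_bound {χ : ℕ → ℝ} {B θ : ℝ} (hB : ∀ t : ℝ, 1 ≤ t → |sgS χ t| ≤ B * t ^ θ)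
    {s : ℂ} (hs : θ < s.re) : ‖sgL χ s‖ ≤ ‖s‖ * (B / (s.re - θ)) := by
  rw [sgL_eq_int, norm_mul]
  gcongr
  have hint : MeasureTheory.IntegrableOn (fun t : ℝ ↦ B * t ^ (θ - s.re - 1)) (Set.Ioi 1) :=
    (integrableOn_Ioi_rpow_of_lt (by linarith) one_pos).const_mul _
  refine (MeasureTheory.norm_integral_le_of_norm_le hint ?_).trans ?_
  · refine (MeasureTheory.ae_restrict_iff' measurableSet_Ioi).mpr
      (Filter.Eventually.of_forall fun t ht ↦ ?_)
    have ht1 : (1:ℝ) < t := ht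
    have ht0 : 0 < t := by linarith
    rw [norm_mul, Complex.norm_cpow_eq_rpow_re_of_pos ht0, Complex.norm_real, Real.norm_eq_abs]
    calc _ ≤ t ^ (-s - 1).re * (B * t ^ θ) := by gcongr; exact hB t ht1.le
      _ = B * (t ^ (-s - 1).re * t ^ θ) := by ring
      _ = _ := by
        rw [← Real.rpow_add ht0]; congr 2; simp; ring
  · rw [MeasureTheory.integral_const_mul, integral_Ioi_rpow_of_lt (by linarith) one_pos]
    apply le_of_eq
    simp only [Real.one_rpow]
    have : s.re - θ ≠ 0 := by linarith
    have : θ - s.re - 1 + 1 ≠ 0 := by intro h; apply this; linarith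
    field_simp
    ring

/-- real version -/
noncomputable def sgLr (χ : ℕ → ℝ) (x : ℝ) : ℝ := (sgL χ x).re

theorem sgL_real (χ : ℕ → ℝ) (x : ℝ) : sgL χ x = (sgLr χ x : ℂ) := by
  have : ∃ r : ℝ, sgL χ x = r := by
    rw [sgL_eq_int]
    refine ⟨x * ∫ t in Set.Ioi (1 : ℝ), t ^ (-x - 1) * sgS χ t, ?_⟩
    rw [Complex.ofReal_mul, ← integral_complex_ofReal]
    congr 1
    refine MeasureTheory.setIntegral_congr_fun measurableSet_Ioi fun t ht ↦ ?_
    have ht1 : (1:ℝ) < t := ht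
    rw [Complex.ofReal_mul, Complex.ofReal_cpow (by linarith)]
    push_cast
    rfl
  obtain ⟨r, hr⟩ := this
  rw [sgLr, hr, Complex.ofReal_re]

theorem SgChar.cont {χ : ℕ → ℝ} {q : ℝ} (h : SgChar χ q) :
    ContinuousOn (sgLr χ) (Set.Ioi 0) := by
  unfold sgLr
  refine Complex.continuous_re.comp_continuousOn (h.diff.continuousOn.comp
    Complex.continuous_ofReal.continuousOn ?_)
  intro x hx
  simpa using hx

/-- disc bound -/
theorem SgChar.disc {χ : ℕ → ℝ} {q : ℝ} (h : SgChar χ q) {s : ℂ}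
    (hs : s ∈ Metric.closedBall (2 : ℂ) (4/3)) : ‖sgL χ s‖ ≤ 5 * q := by
  rw [Metric.mem_closedBall, Complex.dist_eq] at hs
  have h1 := (_root_.abs_le.mp ((Complex.abs_re_le_norm (s - 2)).trans hs)).1
  simp only [Complex.sub_re, Complex.re_ofNat] at h1
  have h2 : ‖s‖ ≤ 10/3 := by
    have := norm_add_le (s - 2) 2
    simp only [sub_add_cancel] at this
    norm_num at this ⊢
    linarith
  have hq := h.hq
  have := sgL_bound (χ := χ) (B := q) (θ := 0) (fun t _ ↦ by simpa using h.S_le t)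
    (s := s) (by linarith)
  refine this.trans ?_
  have h3 : q / (s.re - 0) ≤ q / (2/3) := by gcongr; linarith
  calc ‖s‖ * (q / (s.re - 0)) ≤ 10/3 * (q / (2/3)) := by
        apply mul_le_mul h2 h3 _ (by norm_num)
        apply div_nonneg <;> linarith
    _ = 5 * q := by ring

theorem SgChar.one_bound {χ : ℕ → ℝ} {q : ℝ} (h : SgChar χ q) {ε : ℝ} (he : 0 < ε) (he1 : ε ≤ 1) :
    |sgLr χ 1| ≤ q ^ ε / ε := by
  have hq := h.hq
  have := sgL_bound (χ := χ) (B := q ^ ε) (θ := 1 - ε) (fun t ht ↦ by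
    have h1 := h.S_le t
    have h2 := h.S_le' (t := t) (by linarith)
    have e : |sgS χ t| = |sgS χ t| ^ ε * |sgS χ t| ^ (1 - ε) := by
      rw [← Real.rpow_add' (abs_nonneg _) (by simp)]; simp
    rw [e]
    exact mul_le_mul (Real.rpow_le_rpow (abs_nonneg _) h1 he.le)
      (Real.rpow_le_rpow (abs_nonneg _) h2 (by linarith)) (by positivity) (by positivity))
    (s := ((1 : ℝ) : ℂ)) (by simpa using he)
  rw [sgL_real, Complex.norm_real, Real.norm_eq_abs] at this
  simpa using this


section
open ArithmeticFunction

/-- cast to complex -/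
noncomputable abbrev sgc (f : ArithmeticFunction ℝ) : ℕ → ℂ := fun n ↦ (f n : ℂ)

theorem sgc_mul {f g : ArithmeticFunction ℝ} {s v w : ℂ} (hf : LSeriesHasSum (sgc f) s v)
    (hg : LSeriesHasSum (sgc g) s w) : LSeriesHasSum (sgc (f * g)) s (v * w) := by
  have := hf.convolution hg
  convert this using 1
  ext n
  rw [LSeries.convolution_def]
  simp [sgc, ArithmeticFunction.mul_apply]

/-- the arithmetic function of a character -/
noncomputable def sgX (χ : ℕ → ℝ) : ArithmeticFunction ℝ := ⟨fun n ↦ if n = 0 then 0 else χ n, by simp⟩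

noncomputable def sgZ : ArithmeticFunction ℝ := ((ArithmeticFunction.zeta : ArithmeticFunction ℕ) : ArithmeticFunction ℝ)

theorem sgX_apply {χ : ℕ → ℝ} {n : ℕ} (hn : n ≠ 0) : sgX χ n = χ n := by simp [sgX, hn]

theorem SgChar.X_mult {χ : ℕ → ℝ} {q : ℝ} (h : SgChar χ q) : (sgX χ).IsMultiplicative := by
  rw [ArithmeticFunction.IsMultiplicative.iff_ne_zero]
  refine ⟨by rw [sgX_apply one_ne_zero, h.one], fun {m n} hm hn _ ↦ ?_⟩
  rw [sgX_apply (mul_ne_zero hm hn), sgX_apply hm, sgX_apply hn, h.mul]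

theorem SgChar.X_hasSum {χ : ℕ → ℝ} {q : ℝ} (h : SgChar χ q) {s : ℂ} (hs : 1 < s.re) :
    LSeriesHasSum (sgc (sgX χ)) s (sgL χ s) := by
  rw [← h.eq hs]
  have e : sgc (sgX χ) = fun n ↦ (χ n : ℂ) := by
    ext n
    rcases eq_or_ne n 0 with rfl | hn
    · simp [h.zero]
    · simp [sgX_apply hn]
  rw [e]
  exact (h.summable hs).LSeriesHasSum

theorem sgZ_mult : sgZ.IsMultiplicative := isMultiplicative_zeta.natCast

theorem sgZ_hasSum {s : ℂ} (hs : 1 < s.re) : LSeriesHasSum (sgc sgZ) s (riemannZeta s) := by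
  have := LSeriesHasSum_zeta hs
  convert this using 1
  ext n
  by_cases hn : n = 0 <;> simp [sgc, sgZ, hn]

theorem sg_nonneg_of_prime_pow {f : ArithmeticFunction ℝ} (hf : f.IsMultiplicative)
    (h : ∀ p k : ℕ, p.Prime → 0 ≤ f (p ^ k)) (n : ℕ) : 0 ≤ f n := by
  rcases eq_or_ne n 0 with rfl | hn
  · simp
  · rw [hf.multiplicative_factorization _ hn]
    exact Finset.prod_nonneg fun p hp ↦ h _ _ (Nat.prime_of_mem_primeFactors hp)

theorem SgChar.pow {χ : ℕ → ℝ} {q : ℝ} (h : SgChar χ q) (n k : ℕ) : χ (n ^ k) = χ n ^ k := by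
  induction k with
  | zero => simp [h.one]
  | succ k ih => rw [pow_succ, h.mul, ih, pow_succ]

theorem SgChar.ZX {χ : ℕ → ℝ} {q : ℝ} (h : SgChar χ q) {p : ℕ} (hp : p.Prime) (k : ℕ) :
    (sgZ * sgX χ) (p ^ k) = ∑ i ∈ Finset.range (k + 1), χ p ^ i := by
  rw [sgZ, coe_zeta_mul_apply, Nat.sum_divisors_prime_pow hp]
  refine Finset.sum_congr rfl fun i _ ↦ ?_
  rw [sgX_apply (pow_ne_zero _ hp.ne_zero), h.pow]

theorem SgChar.ZX_nonneg {χ : ℕ → ℝ} {q : ℝ} (h : SgChar χ q) {p : ℕ} (hp : p.Prime) (k : ℕ) :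
    0 ≤ (sgZ * sgX χ) (p ^ k) := by
  rw [h.ZX hp]
  rcases h.val p with e | e | e
  · rw [e, neg_one_geom_sum]; split_ifs <;> norm_num
  · rw [e]; exact Finset.sum_nonneg fun i _ ↦ by positivity
  · rw [e]; exact Finset.sum_nonneg fun i _ ↦ by positivity

theorem SgChar.X_mul_X {χ ψ : ℕ → ℝ} {q : ℝ} (h : SgChar χ q) (n : ℕ) (hn : n ≠ 0) :
    (sgX χ * sgX (fun n ↦ ψ n * χ n)) n = χ n * (sgZ * sgX ψ) n := by
  rw [mul_apply, mul_apply, Finset.mul_sum]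
  refine Finset.sum_congr rfl fun x hx ↦ ?_
  obtain ⟨hx, -⟩ := Nat.mem_divisorsAntidiagonal.mp hx
  have h1 : x.1 ≠ 0 := by rintro h; simp [h] at hx; exact hn hx.symm
  have h2 : x.2 ≠ 0 := by rintro h; simp [h] at hx; exact hn hx.symm
  rw [sgX_apply h1, sgX_apply h2, sgX_apply h2, ← hx, h.mul]
  simp [sgZ, h1]; ring

theorem sg_mul_nonneg {f g : ArithmeticFunction ℝ} {p : ℕ} (hp : p.Prime)
    (hf : ∀ k, 0 ≤ f (p ^ k)) (hg : ∀ k, 0 ≤ g (p ^ k)) (k : ℕ) : 0 ≤ (f * g) (p ^ k) := by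
  rw [mul_apply]
  refine Finset.sum_nonneg fun x hx ↦ ?_
  obtain ⟨hx, -⟩ := Nat.mem_divisorsAntidiagonal.mp hx
  obtain ⟨i, -, hi⟩ := (Nat.dvd_prime_pow hp).mp (Dvd.intro _ hx)
  obtain ⟨j, -, hj⟩ := (Nat.dvd_prime_pow hp).mp (Dvd.intro_left _ hx)
  rw [hi, hj]
  exact mul_nonneg (hf i) (hg j)

theorem sg_four_nonneg {χ ψ : ℕ → ℝ} {q r t : ℝ} (h : SgChar χ q) (h' : SgChar ψ r)
    (h'' : SgChar (fun n ↦ χ n * ψ n) t) (n : ℕ) :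
    0 ≤ ((sgZ * sgX χ) * (sgX ψ * sgX (fun n ↦ χ n * ψ n))) n := by
  apply sg_nonneg_of_prime_pow ((sgZ_mult.mul h.X_mult).mul (h'.X_mult.mul h''.X_mult))
  intro p k hp
  by_cases hv : 0 ≤ ψ p
  · apply sg_mul_nonneg hp (h.ZX_nonneg hp)
    intro k
    rw [h'.X_mul_X _ (pow_ne_zero _ hp.ne_zero), h'.pow]
    exact mul_nonneg (pow_nonneg hv _) (h.ZX_nonneg hp k)
  · have hv1 : ψ p = -1 := by
      rcases h'.val p with e | e | e
      · exact e
      · exact absurd e.ge hv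
      · rw [e] at hv; norm_num at hv
    have e : (sgZ * sgX χ) * (sgX ψ * sgX (fun n ↦ χ n * ψ n)) =
        (sgZ * sgX ψ) * (sgX χ * sgX (fun n ↦ ψ n * χ n)) := by
      rw [show (fun n ↦ ψ n * χ n) = (fun n ↦ χ n * ψ n) by funext n; ring]
      ring
    rw [e]
    apply sg_mul_nonneg hp (h'.ZX_nonneg hp)
    intro k
    rw [h.X_mul_X _ (pow_ne_zero _ hp.ne_zero), h.pow, h'.ZX hp, hv1, neg_one_geom_sum]
    split_ifs with hk
    · simp
    · have : Even k := by
        by_contra hk'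
        exact hk (Nat.not_even_iff_odd.mp hk').add_one
      rw [mul_one]
      exact this.pow_nonneg _

theorem SgChar.pos {χ : ℕ → ℝ} {q : ℝ} (h : SgChar χ q) {x : ℝ} (hx : 1 < x) : 0 < sgLr χ x := by
  have hx' : 1 < (x : ℂ).re := by simpa using hx
  have h1 := sgc_mul (sgZ_hasSum hx') (h.X_hasSum hx')
  have hn := fun n ↦ sg_nonneg_of_prime_pow (sgZ_mult.mul h.X_mult) (fun p k hp ↦ h.ZX_nonneg hp k) n
  open scoped ComplexOrder in
  have key : 0 < riemannZeta x * sgL χ x := by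
    rw [← h1.LSeries_eq]
    refine LSeries.positive (fun n ↦ ?_) ?_ ?_
    · simpa using hn n
    · have : (sgZ * sgX χ) 1 = 1 := (sgZ_mult.mul h.X_mult).map_one
      simp [this]
    · refine lt_of_le_of_lt (LSeries.abscissaOfAbsConv_le_of_forall_lt_LSeriesSummable' (x := 1)
        fun y hy ↦ ?_) (by exact_mod_cast hx)
      have hy' : 1 < (y : ℂ).re := by simpa using (by exact_mod_cast hy : (1:ℝ) < y)
      exact (sgc_mul (sgZ_hasSum hy') (h.X_hasSum hy')).LSeriesSummable
  have hz : 0 < (riemannZeta x).re ∧ (riemannZeta x).im = 0 := by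
    have := (sgZ_hasSum hx').LSeries_eq
    open scoped ComplexOrder in
    have k2 : 0 < riemannZeta x := by
      rw [← this]
      refine LSeries.positive (fun n ↦ ?_) ?_ ?_
      · by_cases h : n = 0 <;> simp [sgZ, h]
      · simp [sgZ]
      · refine lt_of_le_of_lt (LSeries.abscissaOfAbsConv_le_of_forall_lt_LSeriesSummable' (x := 1)
          fun y hy ↦ ?_) (by exact_mod_cast hx)
        have hy' : 1 < (y : ℂ).re := by simpa using (by exact_mod_cast hy : (1:ℝ) < y)
        exact (sgZ_hasSum hy').LSeriesSummable
    rw [Complex.lt_def] at k2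
    exact ⟨by simpa using k2.1, by simpa using k2.2.symm⟩
  rw [Complex.lt_def, sgL_real] at key
  have := key.1
  simp at this
  exact pos_of_mul_pos_right this hz.1.le

theorem SgChar.one_nonneg {χ : ℕ → ℝ} {q : ℝ} (h : SgChar χ q) : 0 ≤ sgLr χ 1 := by
  have hc : ContinuousAt (sgLr χ) 1 := h.cont.continuousAt (Ioi_mem_nhds one_pos)
  have ht : Filter.Tendsto (sgLr χ) (nhdsWithin 1 (Set.Ioi 1)) (nhds (sgLr χ 1)) :=
    hc.tendsto.mono_left nhdsWithin_le_nhds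
  refine ge_of_tendsto ht ?_
  filter_upwards [self_mem_nhdsWithin] with x hx
  exact (h.pos hx).le

theorem SgChar.pos_of_ne {χ : ℕ → ℝ} {q : ℝ} (h : SgChar χ q) {x : ℝ} (hx0 : 0 < x) (hx1 : x < 1)
    (hne : ∀ y, x ≤ y → y < 1 → sgLr χ y ≠ 0) (hne1 : sgLr χ 1 ≠ 0) : 0 < sgLr χ x := by
  by_contra hcon
  push Not at hcon
  have hc : ContinuousOn (sgLr χ) (Set.Icc x 1) := h.cont.mono fun y hy ↦ lt_of_lt_of_le hx0 hy.1
  have := intermediate_value_Icc hx1.le hc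
  obtain ⟨y, hy, e⟩ := this ⟨hcon, h.one_nonneg⟩
  rcases hy.2.lt_or_eq with hy1 | hy1
  · exact hne y hy.1 hy1 e
  · rw [hy1] at e; exact hne1 e

end


section
open Metric

theorem sg_zeta_neg : ∃ δ : ℝ, 0 < δ ∧ ∀ x : ℝ, 1 - δ < x → x < 1 → (riemannZeta x).re < 0 := by
  have h := riemannZeta_residue_one
  have h1 : Filter.Tendsto (fun s : ℂ ↦ ((s - 1) * riemannZeta s).re) (nhdsWithin 1 {1}ᶜ) (nhds 1) :=
    (Complex.continuous_re.tendsto _).comp h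
  have h2 := h1.eventually (lt_mem_nhds (show (0:ℝ) < 1 by norm_num))
  rw [eventually_nhdsWithin_iff, Metric.eventually_nhds_iff] at h2
  obtain ⟨δ, hδ, h3⟩ := h2
  refine ⟨δ, hδ, fun x hx hx1 ↦ ?_⟩
  have h4 := h3 (y := (x : ℂ)) (by
    rw [Complex.dist_eq, show (x : ℂ) - 1 = ((x - 1 : ℝ) : ℂ) by push_cast; ring, Complex.norm_real,
      Real.norm_eq_abs, abs_lt]
    constructor <;> linarith) (by
      simp only [Set.mem_compl_iff, Set.mem_singleton_iff]
      intro h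
      have : x = 1 := by exact_mod_cast h
      linarith)
  rw [show (x : ℂ) - 1 = ((x - 1 : ℝ) : ℂ) by push_cast; ring, Complex.re_ofReal_mul] at h4
  nlinarith

/-- Siegel's theorem, abstractly -/
theorem sg_siegel (P : ℤ → Prop) (χ : ℤ → ℕ → ℝ) (q : ℤ → ℝ) (hχ : ∀ d, P d → SgChar (χ d) (q d))
    (hχ2 : ∀ d e, P d → P e → d ≠ e → SgChar (fun n ↦ χ d n * χ e n) (q d * q e))
    (hχ1 : ∀ d, P d → sgLr (χ d) 1 ≠ 0) (ε : ℝ) (hε : 0 < ε) :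
    ∃ c : ℝ, 0 < c ∧ ∃ d0 : ℤ, ∀ d, P d → d ≠ d0 → c * q d ^ (-ε) ≤ sgLr (χ d) 1 := by
  obtain ⟨δ0, hδ0, hz⟩ := sg_zeta_neg
  obtain ⟨A, C1, hA, hC1, key⟩ := sg_lemmaG
  set δ : ℝ := min (δ0 / 2) (min (1/8) (ε / (4 * A))) with hδ
  have hδpos : 0 < δ := by positivity
  have hδ1 : δ < δ0 := lt_of_le_of_lt (min_le_left _ _) (by linarith)
  have hδ2 : δ ≤ 1/8 := (min_le_right _ _).trans (min_le_left _ _)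
  have hδ3 : A * δ ≤ ε / 4 := by
    have : δ ≤ ε / (4 * A) := (min_le_right _ _).trans (min_le_right _ _)
    rw [le_div_iff₀ (by positivity)] at this
    linarith
  by_cases hcase : ∃ d1, P d1 ∧ ∃ β : ℝ, 1 - δ ≤ β ∧ β < 1 ∧ sgLr (χ d1) β = 0
  · obtain ⟨d1, hd1, β, hβ, hβ1, h0⟩ := hcase
    have h1 := hχ d1 hd1
    set η : ℝ := min (ε/2) 1 with hη
    have hηpos : 0 < η := by positivity
    have hq1 := h1.hq
    set c0 : ℝ := (1 - β) * C1 * (125 * q d1 ^ 2) ^ (-(A * (1 - β))) with hc0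
    have hc0pos : 0 < c0 := by
      have : 0 < 1 - β := by linarith
      positivity
    refine ⟨c0 / (q d1 * (q d1 ^ η / η)), by positivity, d1, fun d hd hne ↦ ?_⟩
    have h2 := hχ d hd
    have hq2 := h2.hq
    have h12 := hχ2 d1 d hd1 hd hne.symm
    set G : ℂ → ℂ := fun s ↦ sgL (χ d1) s * (sgL (χ d) s * sgL (fun n ↦ χ d1 n * χ d n) s) with hG
    have hmain := key (sgc ((sgZ * sgX (χ d1)) * (sgX (χ d) * sgX (fun n ↦ χ d1 n * χ d n)))) G
      ((5 * q d1) * ((5 * q d) * (5 * (q d1 * q d))))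
      (sgLr (χ d1) 1 * (sgLr (χ d) 1 * sgLr (fun n ↦ χ d1 n * χ d n) 1))
      (fun n ↦ ⟨_, sg_four_nonneg h1 h2 h12 n, rfl⟩)
      (by
        have := ((sgZ_mult.mul h1.X_mult).mul (h2.X_mult.mul h12.X_mult)).map_one
        simp only [sgc, this, Complex.ofReal_one])
      (fun s hs ↦ (sgc_mul (sgc_mul (sgZ_hasSum hs) (h1.X_hasSum hs))
        (sgc_mul (h2.X_hasSum hs) (h12.X_hasSum hs))).LSeriesSummable)
      (fun s hs ↦ by
        rw [(sgc_mul (sgc_mul (sgZ_hasSum hs) (h1.X_hasSum hs))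
          (sgc_mul (h2.X_hasSum hs) (h12.X_hasSum hs))).LSeries_eq, hG, mul_assoc])
      (h1.diff.mul (h2.diff.mul h12.diff))
      (fun s hs ↦ by
        simp only [hG, norm_mul]
        have a1 := h1.disc hs
        have a2 := h2.disc hs
        have a3 := h12.disc hs
        gcongr)
      (by
        have e1 := sgL_real (χ d1) 1
        have e2 := sgL_real (χ d) 1
        have e3 := sgL_real (fun n ↦ χ d1 n * χ d n) 1
        rw [Complex.ofReal_one] at e1 e2 e3
        simp only [hG, e1, e2, e3]
        push_cast
        rfl)
      (by
        have : 1 ≤ q d1 * q d := one_le_mul_of_one_le_of_one_le hq1 hq2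
        have a1 : 1 ≤ 5 * q d1 := by linarith
        have a2 : 1 ≤ 5 * q d := by linarith
        have a3 : 1 ≤ 5 * (q d1 * q d) := by linarith
        exact one_le_mul_of_one_le_of_one_le a1 (one_le_mul_of_one_le_of_one_le a2 a3))
      β (by linarith) hβ1 (by
        simp only [hG]
        rw [sgL_real, h0]; simp)
    have hL1 : |sgLr (χ d1) 1| ≤ q d1 := by simpa using h1.one_bound one_pos le_rfl
    have hL12 := h12.one_bound hηpos (min_le_right _ _)
    have hup : sgLr (χ d1) 1 * (sgLr (χ d) 1 * sgLr (fun n ↦ χ d1 n * χ d n) 1) ≤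
        q d1 * (sgLr (χ d) 1 * ((q d1 * q d) ^ η / η)) := by
      refine (le_abs_self _).trans ?_
      rw [abs_mul, abs_mul, abs_of_nonneg h2.one_nonneg]
      have := h2.one_nonneg
      gcongr
    have e1 : (5 * q d1) * ((5 * q d) * (5 * (q d1 * q d))) = (125 * q d1 ^ 2) * q d ^ 2 := by ring
    rw [e1, Real.mul_rpow (by positivity) (by positivity), ← mul_assoc, ← hc0] at hmain
    have hqp : 0 < q d := by linarith
    have hle : q d ^ (-(ε/2)) ≤ (q d ^ 2) ^ (-(A * (1 - β))) := by
      rw [← Real.rpow_natCast, ← Real.rpow_mul hqp.le]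
      apply Real.rpow_le_rpow_of_exponent_le hq2
      push_cast
      have : A * (1 - β) ≤ A * δ := by gcongr; linarith
      linarith
    have hη2 : q d ^ η ≤ q d ^ (ε/2) := Real.rpow_le_rpow_of_exponent_le hq2 (min_le_left _ _)
    rw [Real.mul_rpow (by linarith) (by linarith)] at hup
    have hfin : c0 * q d ^ (-(ε/2)) ≤ q d1 * (sgLr (χ d) 1 * (q d1 ^ η * q d ^ (ε/2) / η)) := by
      refine ((mul_le_mul_of_nonneg_left hle hc0pos.le).trans hmain).trans (hup.trans ?_)
      have := h2.one_nonneg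
      gcongr
    have e2 : q d ^ (-(ε/2)) = q d ^ (-ε) * q d ^ (ε/2) := by
      rw [← Real.rpow_add hqp]; congr 1; ring
    have hp2 : 0 < q d ^ (ε/2) := by positivity
    rw [e2] at hfin
    have hfin2 : c0 * q d ^ (-ε) ≤ sgLr (χ d) 1 * (q d1 * (q d1 ^ η / η)) := by
      refine le_of_mul_le_mul_right ?_ hp2
      calc _ = c0 * (q d ^ (-ε) * q d ^ (ε/2)) := by ring
        _ ≤ _ := hfin
        _ = _ := by ring
    rw [div_mul_eq_mul_div, div_le_iff₀ (by positivity)]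
    exact hfin2
  · push Not at hcase
    refine ⟨δ * C1 * 5 ^ (-(A * δ)), by positivity, 0, fun d hd _ ↦ ?_⟩
    have h := hχ d hd
    have hq := h.hq
    have hF : (riemannZeta ((1 - δ : ℝ) : ℂ) * sgL (χ d) ((1 - δ : ℝ) : ℂ)).re ≤ 0 := by
      rw [sgL_real, Complex.re_mul_ofReal]
      have hzz := hz (1 - δ) (by linarith) (by linarith)
      have : 0 ≤ sgLr (χ d) (1 - δ) := by
        by_contra hneg
        push Not at hneg
        have hc : ContinuousOn (sgLr (χ d)) (Set.Icc (1 - δ) 2) :=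
          h.cont.mono fun y hy ↦ lt_of_lt_of_le (by linarith) hy.1
        obtain ⟨y, hy, e⟩ := intermediate_value_Icc (by linarith) hc
          ⟨hneg.le, (h.pos (x := 2) (by norm_num)).le⟩
        rcases lt_trichotomy y 1 with h1 | h1 | h1
        · exact hcase d hd y hy.1 h1 e
        · rw [h1] at e
          exact hχ1 d hd e
        · exact (h.pos h1).ne' e
      exact mul_nonpos_of_nonpos_of_nonneg hzz.le this
    have hmain := key (sgc (sgZ * sgX (χ d))) (sgL (χ d)) (5 * q d) (sgLr (χ d) 1)
      (fun n ↦ ⟨_, sg_nonneg_of_prime_pow (sgZ_mult.mul h.X_mult)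
        (fun p k hp ↦ h.ZX_nonneg hp k) n, rfl⟩)
      (by
        have := (sgZ_mult.mul h.X_mult).map_one
        simp only [sgc, this, Complex.ofReal_one])
      (fun s hs ↦ (sgc_mul (sgZ_hasSum hs) (h.X_hasSum hs)).LSeriesSummable)
      (fun s hs ↦ (sgc_mul (sgZ_hasSum hs) (h.X_hasSum hs)).LSeries_eq)
      h.diff (fun s hs ↦ h.disc hs) (by
        have e1 := sgL_real (χ d) 1
        rwa [Complex.ofReal_one] at e1) (by linarith) (1 - δ) (by linarith) (by linarith) hF
    refine le_trans ?_ hmain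
    rw [Real.mul_rpow (by norm_num) (by linarith), sub_sub_cancel]
    rw [← mul_assoc]
    have : q d ^ (-ε) ≤ q d ^ (-(A * δ)) :=
      Real.rpow_le_rpow_of_exponent_le hq (by linarith)
    gcongr
end


section

open Filter Topology

theorem sg_char_aux (f : ℕ → ℝ) (q : ℕ) (hq : 1 ≤ q) (h0 : f 0 = 0) (h1 : f 1 = 1)
    (hm : ∀ m n, f (m * n) = f m * f n) (hv : ∀ n, f n = -1 ∨ f n = 0 ∨ f n = 1)
    (hp : ∀ n, f (n % q) = f n) (hc : ∀ n, ¬ Nat.Coprime n q → f n = 0)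
    (n0 : ℕ) (hn0 : f n0 = -1) : SgChar f q ∧ sgLr f 1 ≠ 0 := by
  have : NeZero q := ⟨by omega⟩
  let ψ : DirichletCharacter ℂ q :=
    { toFun := fun a ↦ (f a.val : ℂ)
      map_one' := by
        show ((f (ZMod.val 1) : ℝ) : ℂ) = 1
        rw [ZMod.val_one_eq_one_mod, hp, h1]; simp
      map_mul' := by
        intro a b
        show ((f (ZMod.val (a * b)) : ℝ) : ℂ) = (f a.val : ℂ) * (f b.val : ℂ)
        rw [ZMod.val_mul, hp, hm]; simp
      map_nonunit' := by
        intro a ha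
        show ((f (ZMod.val a) : ℝ) : ℂ) = 0
        rw [hc, Complex.ofReal_zero]
        intro hco
        apply ha
        rw [← ZMod.natCast_zmod_val a]
        exact (ZMod.isUnit_iff_coprime _ _).2 hco }
  have hψ : ∀ n : ℕ, ψ (n : ZMod q) = (f n : ℂ) := by
    intro n
    show ((f (ZMod.val (n : ZMod q)) : ℝ) : ℂ) = _
    rw [ZMod.val_natCast, hp]
  have hne : ψ ≠ 1 := by
    intro h
    have h2 := hψ n0
    have hu : IsUnit ((n0 : ZMod q)) := by
      rw [ZMod.isUnit_iff_coprime]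
      by_contra hh
      have := hc _ hh
      rw [hn0] at this; norm_num at this
    rw [h, MulChar.one_apply hu, hn0] at h2
    norm_num at h2
  have hsum : ∑ k ∈ Finset.range q, f k = 0 := by
    have h3 := MulChar.sum_eq_zero_of_ne_one hne
    have h4 : ∑ a : ZMod q, ψ a = ∑ k ∈ Finset.range q, (f k : ℂ) := by
      refine Finset.sum_bij (fun a _ ↦ a.val) ?_ ?_ ?_ ?_
      · intro a _; simpa using ZMod.val_lt a
      · intro a _ b _ h; exact ZMod.val_injective q h
      · intro b hb
        exact ⟨(b : ZMod q), Finset.mem_univ _, ZMod.val_cast_of_lt (by simpa using hb)⟩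
      · intro a _; rfl
    rw [h4] at h3
    exact_mod_cast h3
  have habs : ∀ n, |f n| ≤ 1 := fun n ↦ by rcases hv n with e | e | e <;> simp [e]
  have hb : ∀ M : ℕ, |∑ k ∈ Finset.range M, f k| ≤ q := by
    intro M
    induction M using Nat.strong_induction_on with
    | _ M ih =>
      rcases lt_or_ge M q with h | h
      · refine (Finset.abs_sum_le_sum_abs _ _).trans ?_
        refine (Finset.sum_le_sum fun k _ ↦ habs k).trans ?_
        simp only [Finset.sum_const, Finset.card_range, nsmul_eq_mul, mul_one]
        exact_mod_cast h.le
      · obtain ⟨M', rfl⟩ := Nat.exists_eq_add_of_le h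
        rw [Finset.sum_range_add, hsum, zero_add]
        have : ∀ x, f (q + x) = f x := fun x ↦ by rw [← hp, Nat.add_mod_left, hp]
        simp only [this]
        exact ih M' (by omega)
  have hS : SgChar f q :=
    { zero := h0, one := h1, mul := hm, val := hv, hq := by exact_mod_cast hq
      bound := by
        intro N
        have := hb (N + 1)
        rw [Finset.sum_range_succ'] at this
        rw [h0, add_zero] at this
        have e : ∑ k ∈ Finset.Icc 1 N, f k = ∑ k ∈ Finset.range N, f (k + 1) := by
          clear this
          induction N with
          | zero => simp
          | succ n ih => rw [Finset.sum_Icc_succ_top (by omega), ih, Finset.sum_range_succ]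
        rwa [e] }
  refine ⟨hS, ?_⟩
  have hnz : ψ.LFunction 1 ≠ 0 := DirichletCharacter.LFunction_apply_one_ne_zero hne
  have hlim1 : Tendsto (fun x : ℝ ↦ ψ.LFunction (x : ℂ)) (𝓝[>] 1) (𝓝 (ψ.LFunction 1)) := by
    have := ((DirichletCharacter.differentiable_LFunction hne).continuous.comp
      Complex.continuous_ofReal).tendsto 1
    have := this.mono_left (nhdsWithin_le_nhds (s := Set.Ioi 1))
    simpa [Function.comp_def] using this
  have hlim2 : Tendsto (fun x : ℝ ↦ sgL f (x : ℂ)) (𝓝[>] 1) (𝓝 (sgL f 1)) := by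
    have h5 : ContinuousAt (sgL f) 1 := by
      refine (hS.diff.continuousOn).continuousAt ?_
      exact (isOpen_lt continuous_const Complex.continuous_re).mem_nhds (by simp)
    have h6 : Tendsto (fun x : ℝ ↦ (x : ℂ)) (𝓝[>] 1) (𝓝 1) := by
      have := Complex.continuous_ofReal.tendsto 1
      simpa using this.mono_left nhdsWithin_le_nhds
    exact h5.tendsto.comp h6
  have heq : ∀ x : ℝ, 1 < x → ψ.LFunction (x : ℂ) = sgL f (x : ℂ) := by
    intro x hx
    rw [DirichletCharacter.LFunction_eq_LSeries ψ (by simpa using hx), ← hS.eq (by simpa using hx)]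
    congr 1
    funext n
    exact hψ n
  have h7 : ψ.LFunction 1 = sgL f 1 := by
    refine tendsto_nhds_unique hlim1 (hlim2.congr' ?_)
    filter_upwards [self_mem_nhdsWithin] with x hx
    exact (heq x hx).symm
  intro h8
  apply hnz
  rw [h7]
  have := sgL_real f 1
  rw [h8] at this
  simpa using this

noncomputable def sgJ (d : ℤ) (n : ℕ) : ℝ := if Odd n then (jacobiSym d n : ℝ) else 0

theorem sgJ_odd {d : ℤ} {n : ℕ} (h : Odd n) : sgJ d n = (jacobiSym d n : ℝ) := if_pos h

theorem sgJ_even {d : ℤ} {n : ℕ} (h : ¬ Odd n) : sgJ d n = 0 := if_neg h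

theorem sgJ_mul (d : ℤ) (m n : ℕ) : sgJ d (m * n) = sgJ d m * sgJ d n := by
  by_cases hm : Odd m
  · by_cases hn : Odd n
    · rw [sgJ_odd hm, sgJ_odd hn, sgJ_odd (hm.mul hn), jacobiSym.mul_right' d hm.pos.ne' hn.pos.ne']
      push_cast; rfl
    · rw [sgJ_even hn, sgJ_even (by rw [Nat.odd_mul]; tauto), mul_zero]
  · rw [sgJ_even hm, sgJ_even (by rw [Nat.odd_mul]; tauto), zero_mul]

theorem sgJ_val (d : ℤ) (n : ℕ) : sgJ d n = -1 ∨ sgJ d n = 0 ∨ sgJ d n = 1 := by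
  by_cases hn : Odd n
  · rw [sgJ_odd hn]
    rcases jacobiSym.trichotomy d n with h | h | h <;> simp [h]
  · simp [sgJ_even hn]

theorem sgJ_mod (d : ℤ) (q : ℕ) (hq : 4 * d.natAbs ∣ q) (n : ℕ) : sgJ d (n % q) = sgJ d n := by
  have h2 : 2 ∣ q := (Dvd.intro _ (by ring : 2 * (2 * d.natAbs) = 4 * d.natAbs)).trans hq
  have ho : Odd (n % q) ↔ Odd n := by
    rw [Nat.odd_iff, Nat.odd_iff, Nat.mod_mod_of_dvd _ h2]
  by_cases hn : Odd n
  · rw [sgJ_odd hn, sgJ_odd (ho.2 hn), jacobiSym.mod_right d (ho.2 hn), jacobiSym.mod_right d hn,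
      Nat.mod_mod_of_dvd _ hq]
  · rw [sgJ_even hn, sgJ_even (by rwa [ho])]

theorem sgJ_cop (d : ℤ) (n : ℕ) (h : ¬ Nat.Coprime n (4 * d.natAbs)) : sgJ d n = 0 := by
  by_cases hn : Odd n
  · rw [sgJ_odd hn, jacobiSym.eq_zero_iff.2, Int.cast_zero]
    refine ⟨hn.pos.ne', fun hg ↦ h ?_⟩
    have h4 : Nat.Coprime n 4 := by
      have : Nat.Coprime n 2 := Nat.coprime_two_right.2 hn
      exact Nat.Coprime.mul_right this this
    refine Nat.Coprime.mul_right h4 ?_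
    rw [Int.gcd_eq_natAbs] at hg
    exact (Nat.Coprime.symm hg)
  · exact sgJ_even hn

theorem sgJ_char (d : ℤ) (hd : d < 0) :
    SgChar (sgJ d) ((4 * d.natAbs : ℕ) : ℝ) ∧ sgLr (sgJ d) 1 ≠ 0 := by
  have hpos : 0 < d.natAbs := Int.natAbs_pos.2 hd.ne
  refine sg_char_aux (sgJ d) _ (by omega) (sgJ_even (by simp)) (by rw [sgJ_odd odd_one]; simp)
    (sgJ_mul d) (sgJ_val d) (sgJ_mod d _ dvd_rfl) (sgJ_cop d) (4 * d.natAbs - 1) ?_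
  set m := d.natAbs with hm
  have hdm : d = -(m : ℤ) := by omega
  have ho : Odd (4 * m - 1) := by rw [Nat.odd_iff]; omega
  have h3 : (4 * m - 1) % 4 = 3 := by omega
  rw [sgJ_odd ho, hdm, jacobiSym.neg _ ho, ZMod.χ₄_nat_three_mod_four h3]
  have : jacobiSym (m : ℤ) (4 * m - 1) = 1 := by
    have h4 : jacobiSym (4 * (m : ℤ)) (4 * m - 1) = 1 := by
      rw [jacobiSym.mod_left' (a₂ := 1), jacobiSym.one_left]
      have : (4 * (m : ℤ)) = 1 + ((4 * m - 1 : ℕ) : ℤ) := by omega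
      rw [this, Int.add_emod_right]
    rwa [jacobiSym.mul_left, jacobiSym.at_four ho, one_mul] at h4
  rw [this]; norm_num

end


section

theorem sg_jac_one {a : ℤ} (ha : a ≠ 0) {n : ℕ} (ho : Odd n) (h : n ≡ 1 [MOD 4 * a.natAbs]) :
    jacobiSym a n = 1 := by
  have hpos : 0 < a.natAbs := Int.natAbs_pos.2 ha
  rw [jacobiSym.mod_right a ho, h, Nat.mod_eq_of_lt (by omega), jacobiSym.one_right]

theorem sg_exists_n (p : ℕ) (hp : p.Prime) (b e : ℤ) (hb : b ≠ 0) (he : e ≠ 0)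
    (hpb : ¬ (p : ℤ) ∣ b) (hpe : ¬ (p : ℤ) ∣ e) :
    ∃ n : ℕ, Odd n ∧ jacobiSym (p * b) n * jacobiSym e n = -1 := by
  have hpb' : Nat.Coprime p b.natAbs := by
    rw [hp.coprime_iff_not_dvd, ← Int.natCast_dvd]; exact hpb
  have hpe' : Nat.Coprime p e.natAbs := by
    rw [hp.coprime_iff_not_dvd, ← Int.natCast_dvd]; exact hpe
  suffices H : ∃ n : ℕ, n ≡ 1 [MOD 4 * (b.natAbs * e.natAbs)] ∧ jacobiSym p n = -1 by
    obtain ⟨n, h1, h2⟩ := H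
    have ho : Odd n := by
      have := h1.of_dvd (show 2 ∣ 4 * (b.natAbs * e.natAbs) from ⟨2 * (b.natAbs * e.natAbs), by ring⟩)
      rw [Nat.odd_iff]; exact this
    refine ⟨n, ho, ?_⟩
    rw [jacobiSym.mul_left, h2, sg_jac_one hb ho, sg_jac_one he ho]
    · norm_num
    · exact h1.of_dvd (mul_dvd_mul_left 4 (dvd_mul_left _ _))
    · exact h1.of_dvd (mul_dvd_mul_left 4 (dvd_mul_right _ _))
  rcases hp.eq_two_or_odd' with rfl | hodd
  · have hco : Nat.Coprime 8 (b.natAbs * e.natAbs) := by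
      have := (hpb'.mul_right hpe').pow_left 3
      simpa using this
    obtain ⟨n, h1, h2⟩ := Nat.chineseRemainder hco 5 1
    have h8 : n % 8 = 5 := h1
    refine ⟨n, ?_, ?_⟩
    · rw [← Nat.modEq_and_modEq_iff_modEq_mul (Nat.Coprime.coprime_dvd_left (by norm_num) hco)]
      exact ⟨by show n % 4 = 1 % 4; omega, h2⟩
    · have ho : Odd n := by rw [Nat.odd_iff]; omega
      rw [Nat.cast_ofNat, jacobiSym.at_two ho, ZMod.χ₈_nat_mod_eight, h8]
      rfl
  · have : Fact p.Prime := ⟨hp⟩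
    obtain ⟨a, ha⟩ := FiniteField.exists_nonsquare (F := ZMod p) (by
      rw [ZMod.ringChar_zmod_n]; rintro rfl; revert hodd; decide)
    have hco : Nat.Coprime p (4 * (b.natAbs * e.natAbs)) := by
      refine Nat.Coprime.mul_right ?_ (hpb'.mul_right hpe')
      have : Nat.Coprime p 2 := Nat.coprime_two_right.2 hodd
      exact Nat.Coprime.mul_right this this
    obtain ⟨n, h1, h2⟩ := Nat.chineseRemainder hco a.val 1
    refine ⟨n, h2, ?_⟩
    have h4 : n % 4 = 1 := h2.of_dvd (dvd_mul_right 4 _)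
    rw [← jacobiSym.quadratic_reciprocity_one_mod_four h4 hodd]
    rw [ZMod.nonsquare_iff_jacobiSym_eq_neg_one]
    have : ((n : ℤ) : ZMod p) = a := by
      have := (ZMod.natCast_eq_natCast_iff _ _ _).2 h1
      rw [ZMod.natCast_zmod_val] at this
      exact_mod_cast this
    rwa [this]

theorem sg_exists_n2 (d e : ℤ) (hd : d < 0) (he : e < 0) (hds : Squarefree d) (hes : Squarefree e)
    (hne : d ≠ e) : ∃ n : ℕ, Odd n ∧ jacobiSym d n * jacobiSym e n = -1 := by
  have hns : ¬ ∀ p : ℕ, p.Prime → (p ∣ d.natAbs ↔ p ∣ e.natAbs) := by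
    intro h
    have := (Nat.Squarefree.ext_iff (Int.squarefree_natAbs.2 hds) (Int.squarefree_natAbs.2 hes)).2 h
    omega
  have key : ∀ (d e : ℤ), d < 0 → e < 0 → Squarefree d → ∀ p : ℕ, p.Prime → p ∣ d.natAbs →
      ¬ p ∣ e.natAbs → ∃ n : ℕ, Odd n ∧ jacobiSym d n * jacobiSym e n = -1 := by
    intro d e hd he hds p hp h1 h2
    obtain ⟨b, rfl⟩ := Int.natCast_dvd.2 h1
    refine sg_exists_n p hp b e (by rintro rfl; simp at hd) he.ne ?_ (by rwa [Int.natCast_dvd])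
    rintro ⟨c, rfl⟩
    have := hds p ⟨c, by ring⟩
    rw [Int.isUnit_iff] at this
    have := hp.two_le
    omega
  push Not at hns
  obtain ⟨p, hp, h | h⟩ := hns
  · exact key d e hd he hds p hp h.1 h.2
  · obtain ⟨n, hn, h⟩ := key e d he hd hes p hp h.2 h.1
    exact ⟨n, hn, by rw [mul_comm, h]⟩

theorem sgJ_char2 (d e : ℤ) (hd : d < 0) (he : e < 0) (hds : Squarefree d) (hes : Squarefree e)
    (hne : d ≠ e) :
    SgChar (fun n ↦ sgJ d n * sgJ e n) (((4 * d.natAbs : ℕ) : ℝ) * ((4 * e.natAbs : ℕ) : ℝ)) := by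
  have hpos : 0 < d.natAbs := Int.natAbs_pos.2 hd.ne
  have hpos' : 0 < e.natAbs := Int.natAbs_pos.2 he.ne
  obtain ⟨n, ho, hn⟩ := sg_exists_n2 d e hd he hds hes hne
  rw [← Nat.cast_mul]
  refine (sg_char_aux (fun n ↦ sgJ d n * sgJ e n) _ ?_ ?_ ?_ ?_ ?_ ?_ ?_ n ?_).1
  · exact Nat.mul_pos (by omega) (by omega)
  · simp [sgJ]
  · simp [sgJ]
  · intro m n; simp only [sgJ_mul]; ring
  · intro n
    rcases sgJ_val d n with h | h | h <;> rcases sgJ_val e n with h' | h' | h' <;> simp [h, h']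
  · intro n
    simp only [sgJ_mod d _ (dvd_mul_right _ _), sgJ_mod e _ (dvd_mul_left _ _)]
  · intro n hn
    rw [Nat.coprime_mul_iff_right, not_and_or] at hn
    rcases hn with h | h
    · simp [sgJ_cop d n h]
    · simp [sgJ_cop e n h]
  · simp only [sgJ_odd ho]
    exact_mod_cast hn

theorem sg_siegel2 (ε : ℝ) (hε : 0 < ε) :
    ∃ c : ℝ, 0 < c ∧ ∃ d0 : ℤ, ∀ d : ℤ, d < 0 → Squarefree d → d ≠ d0 →
      c * ((4 * d.natAbs : ℕ) : ℝ) ^ (-ε) ≤ sgLr (sgJ d) 1 := by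
  obtain ⟨c, hc, d0, h⟩ := sg_siegel (fun d ↦ d < 0 ∧ Squarefree d) sgJ
    (fun d ↦ ((4 * d.natAbs : ℕ) : ℝ)) (fun d hd ↦ (sgJ_char d hd.1).1)
    (fun d e hd he hne ↦ sgJ_char2 d e hd.1 he.1 hd.2 he.2 hne) (fun d hd ↦ (sgJ_char d hd.1).2) ε hε
  exact ⟨c, hc, d0, fun d h1 h2 h3 ↦ h d ⟨h1, h2⟩ h3⟩

end


section

open NumberField Ideal

noncomputable def sgA (K : Type) [Field K] [NumberField K] (n : ℕ) : ℕ :=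
  Nat.card {I : Ideal (𝓞 K) // absNorm I = n}

theorem sgA_finite (K : Type) [Field K] [NumberField K] (n : ℕ) :
    Finite {I : Ideal (𝓞 K) // absNorm I = n} :=
  (Ideal.finite_setOfPred_absNorm_eq (S := 𝓞 K) n).to_subtype

theorem sgA_pos {K : Type} [Field K] [NumberField K] {n : ℕ} (I : Ideal (𝓞 K))
    (h : absNorm I = n) : 1 ≤ sgA K n := by
  have := sgA_finite K n
  have : Nonempty {I : Ideal (𝓞 K) // absNorm I = n} := ⟨⟨I, h⟩⟩
  exact Nat.card_pos

theorem sgA_mul (K : Type) [Field K] [NumberField K] {m n : ℕ} (h : Nat.Coprime m n) :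
    sgA K m * sgA K n ≤ sgA K (m * n) := by
  have := sgA_finite K (m * n)
  unfold sgA
  rw [← Nat.card_prod]
  let g : {I : Ideal (𝓞 K) // absNorm I = m} × {I : Ideal (𝓞 K) // absNorm I = n} →
      {I : Ideal (𝓞 K) // absNorm I = m * n} :=
    fun x ↦ ⟨x.1.1 * x.2.1, by rw [map_mul, x.1.2, x.2.2]⟩
  refine Nat.card_le_card_of_injective g ?_
  have hco : ∀ I J : Ideal (𝓞 K), absNorm I = m → absNorm J = n → IsCoprime I J := by
    intro I J hI hJ
    rw [Ideal.isCoprime_iff_sup_eq, Ideal.eq_top_iff_one]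
    have h1 : (m : 𝓞 K) ∈ I ⊔ J := Ideal.mem_sup_left (hI ▸ absNorm_mem I)
    have h2 : (n : 𝓞 K) ∈ I ⊔ J := Ideal.mem_sup_right (hJ ▸ absNorm_mem J)
    obtain ⟨u, v, huv⟩ := Nat.isCoprime_iff_coprime.2 h
    have h3 : (u : 𝓞 K) * m + v * n = 1 := by exact_mod_cast congrArg (Int.cast : ℤ → 𝓞 K) huv
    rw [← h3]
    exact add_mem (Ideal.mul_mem_left _ _ h1) (Ideal.mul_mem_left _ _ h2)
  rintro ⟨⟨I, hI⟩, ⟨J, hJ⟩⟩ ⟨⟨I', hI'⟩, ⟨J', hJ'⟩⟩ he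
  have he : I * J = I' * J' := congrArg Subtype.val he
  have e1 : I = I' := by
    apply dvd_antisymm
    · exact (hco I J' hI hJ').dvd_of_dvd_mul_right (he ▸ dvd_mul_right I J)
    · exact (hco I' J hI' hJ).dvd_of_dvd_mul_right (he ▸ dvd_mul_right I' J')
  have e2 : J = J' := by
    apply dvd_antisymm
    · exact (hco I' J hI' hJ).symm.dvd_of_dvd_mul_left (he ▸ dvd_mul_left J I)
    · exact (hco I J' hI hJ').symm.dvd_of_dvd_mul_left (he ▸ dvd_mul_left J' I')
  subst e1; subst e2; rfl

theorem sg_minpoly {K : Type} [Field K] [NumberField K] {d : ℤ} (hd : d < 0) {α : K}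
    (hα : α ^ 2 = (d : K)) : minpoly ℚ α = Polynomial.X ^ 2 - Polynomial.C (d : ℚ) := by
  have hdeg : (Polynomial.X ^ 2 - Polynomial.C (d : ℚ)).natDegree = 2 :=
    Polynomial.natDegree_X_pow_sub_C
  symm
  apply minpoly.eq_of_irreducible_of_monic
  · rw [Polynomial.irreducible_iff_roots_eq_zero_of_degree_le_three (by rw [hdeg])
      (by rw [hdeg]; norm_num), Multiset.eq_zero_iff_forall_notMem]
    intro x hx
    have := Polynomial.isRoot_of_mem_roots hx
    simp only [Polynomial.IsRoot.def, Polynomial.eval_sub, Polynomial.eval_pow, Polynomial.eval_X,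
      Polynomial.eval_C] at this
    have h1 : (d : ℚ) < 0 := by exact_mod_cast hd
    nlinarith [sq_nonneg x]
  · simp [hα]
  · exact Polynomial.monic_X_pow_sub_C _ two_ne_zero

theorem sg_trace {K : Type} [Field K] [NumberField K] {d : ℤ} (hd : d < 0) {α : K}
    (hα : α ^ 2 = (d : K)) : Algebra.trace ℚ K α = 0 := by
  rw [trace_eq_finrank_mul_minpoly_nextCoeff, sg_minpoly hd hα, Polynomial.nextCoeff_of_natDegree_pos]
  · rw [Polynomial.natDegree_X_pow_sub_C]
    rw [Polynomial.coeff_sub, Polynomial.coeff_X_pow, Polynomial.coeff_C]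
    simp
  · rw [Polynomial.natDegree_X_pow_sub_C]; norm_num

theorem sg_traceZ {K : Type} [Field K] [NumberField K] {d : ℤ} (hd : d < 0) {a : 𝓞 K}
    (ha : a ^ 2 = (d : 𝓞 K)) : Algebra.trace ℤ (𝓞 K) a = 0 := by
  have h := Algebra.coe_trace_int a
  rw [sg_trace hd (α := (a : K)) (by have := congrArg (algebraMap (𝓞 K) K) ha; simpa using this)] at h
  exact_mod_cast h

theorem sg_norm_p {K : Type} [Field K] [NumberField K] (h2 : Module.finrank ℚ K = 2) (p : ℕ) :
    absNorm (Ideal.span {(p : 𝓞 K)}) = p ^ 2 := by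
  rw [Ideal.absNorm_span_natCast, RingOfIntegers.rank, h2]

theorem sg_not_dvd {K : Type} [Field K] [NumberField K] (h2 : Module.finrank ℚ K = 2)
    {d : ℤ} (hd : d < 0) {a : 𝓞 K} (ha : a ^ 2 = (d : 𝓞 K)) {p : ℕ} {r : ℤ}
    (h : (p : 𝓞 K) ∣ a + (r : 𝓞 K)) : (p : ℤ) ∣ 2 * r := by
  obtain ⟨x, hx⟩ := h
  have h1 := congrArg (Algebra.trace ℤ (𝓞 K)) hx
  rw [map_add, sg_traceZ hd ha, zero_add] at h1
  have e1 : (r : 𝓞 K) = algebraMap ℤ (𝓞 K) r := by simp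
  have e2 : (p : 𝓞 K) * x = (p : ℤ) • x := by simp
  rw [e1, Algebra.trace_algebraMap, e2, map_smul, RingOfIntegers.rank, h2] at h1
  refine ⟨Algebra.trace ℤ (𝓞 K) x, ?_⟩
  simpa using h1

theorem sgA_inert {K : Type} [Field K] [NumberField K] (h2 : Module.finrank ℚ K = 2) (p k : ℕ) :
    1 ≤ sgA K (p ^ (2 * k)) := by
  refine sgA_pos (Ideal.span {(p : 𝓞 K)} ^ k) ?_
  rw [map_pow, sg_norm_p h2, pow_mul]

theorem sgA_ram {K : Type} [Field K] [NumberField K] (h2 : Module.finrank ℚ K = 2)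
    {d : ℤ} (hds : Squarefree d) {a : 𝓞 K} (ha : a ^ 2 = (d : 𝓞 K)) {p : ℕ} (hp : p.Prime)
    (hpd : (p : ℤ) ∣ d) (k : ℕ) : 1 ≤ sgA K (p ^ k) := by
  have key : Ideal.span {(p : 𝓞 K), a} * Ideal.span {(p : 𝓞 K), a} = Ideal.span {(p : 𝓞 K)} := by
    rw [Ideal.span_pair_mul_span_pair]
    apply le_antisymm
    · rw [Ideal.span_le]
      intro x hx
      simp only [Set.mem_insert_iff, Set.mem_singleton_iff] at hx
      rw [SetLike.mem_coe, Ideal.mem_span_singleton]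
      rcases hx with rfl | rfl | rfl | rfl
      · exact dvd_mul_right _ _
      · exact dvd_mul_right _ _
      · exact dvd_mul_left _ _
      · rw [← pow_two, ha]; have := map_dvd (Int.castRingHom (𝓞 K)) hpd; simpa using this
    · rw [Ideal.span_singleton_le_iff_mem]
      obtain ⟨b, rfl⟩ := hpd
      have hco : IsCoprime (p : ℤ) b := by
        rw [(Nat.prime_iff_prime_int.1 hp).coprime_iff_not_dvd]
        rintro ⟨c, rfl⟩
        have := hds p ⟨c, by ring⟩
        rw [Int.isUnit_iff] at this
        have := hp.two_le
        omega
      obtain ⟨u, v, huv⟩ := hco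
      have h3 : (u : 𝓞 K) * p + v * b = 1 := by exact_mod_cast congrArg (Int.cast : ℤ → 𝓞 K) huv
      have h4 : (p : 𝓞 K) = u * (p * p) + v * (a * a) := by
        rw [← pow_two a, ha]; push_cast; linear_combination (-(p : 𝓞 K)) * h3
      have : ∀ x : 𝓞 K, (p : 𝓞 K) = x → x ∈ span {(p : 𝓞 K) * p, p * a, a * p, a * a} →
          (p : 𝓞 K) ∈ span {(p : 𝓞 K) * p, p * a, a * p, a * a} := fun x hx h ↦ by rwa [← hx] at h
      refine this _ h4 ?_
      refine add_mem (Ideal.mul_mem_left _ _ (Ideal.subset_span (by simp)))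
        (Ideal.mul_mem_left _ _ (Ideal.subset_span (by simp)))
  have hn := congrArg absNorm key
  rw [map_mul, sg_norm_p h2, ← pow_two] at hn
  have hn : absNorm (Ideal.span {(p : 𝓞 K), a}) = p := Nat.pow_left_injective two_ne_zero hn
  exact sgA_pos (Ideal.span {(p : 𝓞 K), a} ^ k) (by rw [map_pow, hn])

theorem sgA_split {K : Type} [Field K] [NumberField K] (h2 : Module.finrank ℚ K = 2)
    {d : ℤ} (hd : d < 0) {a : 𝓞 K} (ha : a ^ 2 = (d : 𝓞 K)) {p : ℕ} (hp : p.Prime)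
    {r : ℤ} (hr : (p : ℤ) ∣ d - r ^ 2) (hr2 : ¬ (p : ℤ) ∣ 2 * r) (k : ℕ) :
    k + 1 ≤ sgA K (p ^ k) := by
  set P := Ideal.span {(p : 𝓞 K), a + r} with hP
  set Q := Ideal.span {(p : 𝓞 K), a + (-r : ℤ)} with hQ
  have hco : IsCoprime (p : ℤ) (2 * r) :=
    (Nat.prime_iff_prime_int.1 hp).coprime_iff_not_dvd.2 hr2
  obtain ⟨u, v, huv⟩ := hco
  have h3 : (u : 𝓞 K) * p + v * (2 * r) = 1 := by exact_mod_cast congrArg (Int.cast : ℤ → 𝓞 K) huv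
  have key : P * Q = Ideal.span {(p : 𝓞 K)} := by
    rw [hP, hQ, Ideal.span_pair_mul_span_pair]
    apply le_antisymm
    · rw [Ideal.span_le]
      intro x hx
      simp only [Set.mem_insert_iff, Set.mem_singleton_iff] at hx
      rw [SetLike.mem_coe, Ideal.mem_span_singleton]
      rcases hx with rfl | rfl | rfl | rfl
      · exact dvd_mul_right _ _
      · exact dvd_mul_right _ _
      · exact dvd_mul_left _ _
      · have : (a + r) * (a + (-r : ℤ)) = ((d - r ^ 2 : ℤ) : 𝓞 K) := by
          push_cast; rw [← ha]; ring
        rw [this]; have := map_dvd (Int.castRingHom (𝓞 K)) hr; simpa using this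
    · rw [Ideal.span_singleton_le_iff_mem]
      have h4 : (p : 𝓞 K) = u * (p * p) + (v * ((a + r) * p) + (-v) * (p * (a + (-r : ℤ)))) := by
        push_cast; linear_combination (-(p : 𝓞 K)) * h3
      have : ∀ x : 𝓞 K, (p : 𝓞 K) = x → x ∈ span {(p : 𝓞 K) * p, p * (a + (-r : ℤ)), (a + r) * p,
          (a + r) * (a + (-r : ℤ))} → (p : 𝓞 K) ∈ span {(p : 𝓞 K) * p, p * (a + (-r : ℤ)),
          (a + r) * p, (a + r) * (a + (-r : ℤ))} := fun x hx h ↦ by rwa [← hx] at h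
      refine this _ h4 ?_
      refine add_mem (Ideal.mul_mem_left _ _ (Ideal.subset_span (by simp))) (add_mem
        (Ideal.mul_mem_left _ _ (Ideal.subset_span (by simp)))
        (Ideal.mul_mem_left _ _ (Ideal.subset_span (by simp))))
  have hcop : IsCoprime P Q := by
    rw [Ideal.isCoprime_iff_sup_eq, Ideal.eq_top_iff_one]
    have e : (1 : 𝓞 K) = (u * p + v * (a + r)) + (-v) * (a + (-r : ℤ)) := by
      push_cast; linear_combination -h3
    rw [e]
    refine Submodule.add_mem_sup (add_mem (Ideal.mul_mem_left _ _ (Ideal.subset_span (by simp)))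
      (Ideal.mul_mem_left _ _ (Ideal.subset_span (by simp))))
      (Ideal.mul_mem_left _ _ (Ideal.subset_span (by simp)))
  have hPt : P ≠ ⊤ := by
    intro h
    rw [h, Ideal.top_mul] at key
    have : a + (-r : ℤ) ∈ Ideal.span {(p : 𝓞 K)} := key ▸ Ideal.subset_span (by simp)
    rw [Ideal.mem_span_singleton] at this
    have := sg_not_dvd h2 hd ha this
    exact hr2 (by simpa using this)
  have hQt : Q ≠ ⊤ := by
    intro h
    rw [h, Ideal.mul_top] at key
    have : a + r ∈ Ideal.span {(p : 𝓞 K)} := key ▸ Ideal.subset_span (by simp)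
    rw [Ideal.mem_span_singleton] at this
    exact hr2 (sg_not_dvd h2 hd ha this)
  have hn := congrArg absNorm key
  rw [map_mul, sg_norm_p h2, hp.mul_eq_prime_sq_iff (by rwa [Ne, absNorm_eq_one_iff])
    (by rwa [Ne, absNorm_eq_one_iff])] at hn
  have hP0 : P ≠ 0 := by
    rintro h0; rw [h0] at hn; simp at hn; exact hp.ne_zero hn.1.symm
  have := sgA_finite K (p ^ k)
  have hcard : Nat.card (Fin (k + 1)) = k + 1 := by simp
  rw [← hcard]
  let g : Fin (k + 1) → {I : Ideal (𝓞 K) // absNorm I = p ^ k} :=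
    fun i ↦ ⟨P ^ (i : ℕ) * Q ^ (k - i), by
      rw [map_mul, map_pow, map_pow, hn.1, hn.2, ← pow_add]; congr 1; omega⟩
  refine Nat.card_le_card_of_injective g ?_
  have main : ∀ i j : ℕ, i < j → P ^ i * Q ^ (k - i) ≠ P ^ j * Q ^ (k - j) := by
    intro i j hij he
    have e : P ^ j = P ^ i * P ^ (j - i) := by rw [← pow_add]; congr 1; omega
    rw [e, mul_assoc] at he
    have he := mul_left_cancel₀ (pow_ne_zero _ hP0) he
    have h5 : P ∣ Q ^ (k - i) := by
      rw [he]; exact (dvd_pow_self P (by omega)).mul_right _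
    have h6 : IsUnit P := (hcop.pow_right (n := k - i)).isUnit_of_dvd' dvd_rfl h5
    exact hPt (Ideal.isUnit_iff.1 h6)
  intro i j hij
  have hij : P ^ (i : ℕ) * Q ^ (k - i) = P ^ (j : ℕ) * Q ^ (k - j) := congrArg Subtype.val hij
  rcases lt_trichotomy (i : ℕ) j with h | h | h
  · exact absurd hij (main _ _ h)
  · exact Fin.ext h
  · exact absurd hij.symm (main _ _ h)

end


section

open NumberField ArithmeticFunction Filter Topology

theorem sgJ_pow (d : ℤ) (n k : ℕ) : sgJ d (n ^ k) = sgJ d n ^ k := by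
  induction k with
  | zero => simp [sgJ]
  | succ k ih => rw [pow_succ, sgJ_mul, ih, pow_succ]

theorem sgXJ_mult (d : ℤ) : (sgX (sgJ d)).IsMultiplicative := by
  rw [ArithmeticFunction.IsMultiplicative.iff_ne_zero]
  refine ⟨by rw [sgX_apply one_ne_zero]; simp [sgJ], fun {m n} hm hn _ ↦ ?_⟩
  rw [sgX_apply (mul_ne_zero hm hn), sgX_apply hm, sgX_apply hn, sgJ_mul]

theorem sgF_pow (d : ℤ) {p : ℕ} (hp : p.Prime) (k : ℕ) :
    (sgX (sgJ 1) * sgX (sgJ d)) (p ^ k) =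
      ∑ i ∈ Finset.range (k + 1), sgJ 1 p ^ i * sgJ d p ^ (k - i) := by
  rw [ArithmeticFunction.mul_apply, Nat.sum_divisorsAntidiagonal (fun a b ↦ sgX (sgJ 1) a * sgX (sgJ d) b),
    Nat.sum_divisors_prime_pow hp]
  refine Finset.sum_congr rfl fun i hi ↦ ?_
  have : i ≤ k := by simpa [Nat.lt_succ_iff] using hi
  rw [Nat.pow_div this hp.pos, sgX_apply (pow_ne_zero _ hp.ne_zero),
    sgX_apply (pow_ne_zero _ hp.ne_zero), sgJ_pow, sgJ_pow]

theorem sgF_le {K : Type} [Field K] [NumberField K] (h2 : Module.finrank ℚ K = 2)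
    {d : ℤ} (hd : d < 0) (hds : Squarefree d) {a : 𝓞 K} (ha : a ^ 2 = (d : 𝓞 K)) (n : ℕ) :
    0 ≤ (sgX (sgJ 1) * sgX (sgJ d)) n ∧ (sgX (sgJ 1) * sgX (sgJ d)) n ≤ sgA K n := by
  have hmult := (sgXJ_mult 1).mul (sgXJ_mult d)
  have hA1 : 1 ≤ sgA K 1 := sgA_pos ⊤ (by simp)
  induction n using Nat.recOnPosPrimePosCoprime with
  | zero => simp
  | one => rw [hmult.1]; exact ⟨zero_le_one, by exact_mod_cast hA1⟩
  | coprime m n hm hn hmn ihm ihn =>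
    rw [hmult.2 hmn]
    refine ⟨mul_nonneg ihm.1 ihn.1, (mul_le_mul ihm.2 ihn.2 ihn.1 (by positivity)).trans ?_⟩
    exact_mod_cast sgA_mul K hmn
  | prime_pow p k hp hk =>
    rw [sgF_pow d hp]
    rcases hp.eq_two_or_odd' with rfl | ho
    · have e1 : ∀ e : ℤ, sgJ e 2 = 0 := fun e ↦ sgJ_even (by decide)
      rw [Finset.sum_eq_zero]
      · simp
      · intro i hi
        rw [e1, e1]
        rcases Nat.eq_zero_or_pos i with rfl | h
        · simp [hk.ne']
        · simp [h.ne']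
    · have e1 : sgJ 1 p = 1 := by rw [sgJ_odd ho]; simp
      simp only [e1, one_pow, one_mul]
      have : ∑ i ∈ Finset.range (k + 1), sgJ d p ^ (k - i) =
          ∑ i ∈ Finset.range (k + 1), sgJ d p ^ i := by
        rw [← Finset.sum_range_reflect]
        refine Finset.sum_congr rfl fun i hi ↦ ?_
        congr 1
        simp at hi; omega
      rw [this]
      have hF : Fact p.Prime := ⟨hp⟩
      rcases jacobiSym.trichotomy d p with h | h | h
      · have hpd : (p : ℤ) ∣ d := by
          have h' := (jacobiSym.eq_zero_iff.1 h).2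
          rw [Int.gcd_eq_natAbs, Int.natAbs_natCast] at h'
          rw [Int.natCast_dvd]
          by_contra hh
          exact h' ((hp.coprime_iff_not_dvd.2 hh).symm)
        have e2 : sgJ d p = 0 := by rw [sgJ_odd ho, h]; simp
        rw [e2, Finset.sum_range_succ']
        simp only [pow_zero, ne_eq, Nat.add_eq_zero_iff, one_ne_zero, and_false, not_false_eq_true,
          zero_pow, Finset.sum_const_zero, zero_add]
        exact ⟨zero_le_one, by exact_mod_cast sgA_ram h2 hds ha hp hpd k⟩
      · have e2 : sgJ d p = 1 := by rw [sgJ_odd ho, h]; simp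
        rw [e2]
        simp only [one_pow, Finset.sum_const, Finset.card_range, nsmul_eq_mul, mul_one]
        refine ⟨by positivity, ?_⟩
        obtain ⟨x, hx⟩ := ZMod.isSquare_of_jacobiSym_eq_one h
        obtain ⟨r, rfl⟩ := ZMod.intCast_surjective x
        have hr : (p : ℤ) ∣ d - r ^ 2 := by
          rw [← ZMod.intCast_zmod_eq_zero_iff_dvd]
          push_cast; rw [hx]; ring
        have hpd : ¬ (p : ℤ) ∣ d := by
          intro hh
          have : jacobiSym d p = 0 := by
            rw [jacobiSym.eq_zero_iff]
            refine ⟨hp.ne_zero, ?_⟩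
            rw [Int.gcd_eq_natAbs, Int.natAbs_natCast]
            rw [Int.natCast_dvd] at hh
            exact fun hc ↦ (hp.coprime_iff_not_dvd.1 (Nat.Coprime.symm hc)) hh
          rw [this] at h; norm_num at h
        have hr2 : ¬ (p : ℤ) ∣ 2 * r := by
          intro hh
          have hpp := Nat.prime_iff_prime_int.1 hp
          rcases hpp.dvd_or_dvd hh with h' | h'
          · have : p ∣ 2 := by exact_mod_cast h'
            rw [Nat.prime_dvd_prime_iff_eq hp Nat.prime_two] at this
            subst this; revert ho; decide
          · apply hpd
            have := dvd_add hr (dvd_pow h' two_ne_zero)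
            simpa using this
        exact_mod_cast sgA_split h2 hd ha hp hr hr2 k
      · have e2 : sgJ d p = -1 := by rw [sgJ_odd ho, h]; simp
        rw [e2, neg_one_geom_sum]
        split_ifs with hev
        · simp
        · have hk2 : Even k := by
            rw [Nat.even_add_one, not_not] at hev; exact hev
          obtain ⟨j, rfl⟩ := hk2
          rw [← two_mul]
          exact ⟨zero_le_one, by exact_mod_cast sgA_inert h2 p j⟩

end


section

open NumberField ArithmeticFunction Filter Topology Ideal

theorem sg_cmp (f g : ℕ → ℝ) (h : ∀ n, f n ≤ g n) (s : ℝ)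
    (hf : LSeriesSummable (fun n ↦ (f n : ℂ)) s) (hg : LSeriesSummable (fun n ↦ (g n : ℂ)) s) :
    (LSeries (fun n ↦ (f n : ℂ)) s).re ≤ (LSeries (fun n ↦ (g n : ℂ)) s).re := by
  refine hasSum_le ?_ (Complex.hasSum_re hf.hasSum) (Complex.hasSum_re hg.hasSum)
  intro n
  rcases eq_or_ne n 0 with rfl | hn
  · simp
  · rw [LSeries.term_of_ne_zero hn, LSeries.term_of_ne_zero hn]
    have e : ((n : ℂ) ^ (s : ℂ)) = (((n : ℝ) ^ s : ℝ) : ℂ) := by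
      rw [Complex.ofReal_cpow (by positivity)]; simp
    rw [e, ← Complex.ofReal_div, ← Complex.ofReal_div, Complex.ofReal_re, Complex.ofReal_re]
    exact div_le_div_of_nonneg_right (h n) (by positivity)

theorem sgA_summable (K : Type) [Field K] [NumberField K] {s : ℂ} (hs : 1 < s.re) :
    LSeriesSummable (fun n ↦ ((sgA K n : ℝ) : ℂ)) s := by
  refine LSeriesSummable_of_sum_norm_bigO_and_nonneg (r := 1) ?_ (fun n ↦ by positivity)
    zero_le_one hs
  have key : Tendsto (fun n : ℕ ↦ (∑ k ∈ Finset.Icc 1 n, (sgA K k : ℝ)) / n) atTop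
      (𝓝 (dedekindZeta_residue K)) := by
    refine ((Ideal.tendsto_norm_le_div_atTop₀ K).comp tendsto_natCast_atTop_atTop).congr fun n ↦ ?_
    simp only [Function.comp_apply, Nat.cast_le, ← Nat.cast_sum, sgA]
    congr
    rw [← add_left_inj 1, ← card_norm_le_eq_card_norm_le_add_one,
      show Finset.Icc 1 n = Finset.Ioc 0 n from Finset.Icc_succ_left_eq_Ioc _ _,
      show 1 = Nat.card {I : Ideal (𝓞 K) // absNorm I = 0} by simp [Ideal.absNorm_eq_zero_iff],
      Finset.sum_Ioc_add_eq_sum_Icc (n.zero_le),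
      ← Finset.card_preimage_eq_sum_card_image_eq (fun k _ ↦ finite_setOfPred_absNorm_eq k)]
    simp [Set.coe_eq_subtype]
  have h1 := key.isBigO_one ℝ
  have h2 := h1.mul (Asymptotics.isBigO_refl (fun n : ℕ ↦ (n : ℝ)) atTop)
  refine (Asymptotics.IsBigO.congr' h2 ?_ ?_)
  · filter_upwards [eventually_ne_atTop 0] with n hn
    field_simp
  · filter_upwards with n
    simp

theorem sgO_hasSum {s : ℂ} (hs : 1 < s.re) :
    LSeriesHasSum (sgc (sgX (sgJ 1))) s (DirichletCharacter.LFunctionTrivChar 2 s) := by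
  unfold DirichletCharacter.LFunctionTrivChar
  rw [DirichletCharacter.LFunction_eq_LSeries _ hs]
  have e : ∀ {n : ℕ}, n ≠ 0 → sgc (sgX (sgJ 1)) n = (1 : DirichletCharacter ℂ 2) (n : ZMod 2) := by
    intro n hn
    simp only [sgc, sgX_apply hn]
    by_cases ho : Odd n
    · rw [sgJ_odd ho, MulChar.one_apply]
      · simp
      · rw [ZMod.isUnit_iff_coprime]; exact Nat.coprime_two_right.2 ho
    · rw [sgJ_even ho, MulChar.map_nonunit]
      · simp
      · rw [ZMod.isUnit_iff_coprime]; rwa [Nat.coprime_two_right]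
  exact (LSeriesHasSum_congr s _ e).2
    (DirichletCharacter.LSeriesSummable_of_one_lt_re _ hs).LSeriesHasSum

theorem sg_residue {K : Type} [Field K] [NumberField K] (h2 : Module.finrank ℚ K = 2)
    {d : ℤ} (hd : d < 0) (hds : Squarefree d) {a : 𝓞 K} (ha : a ^ 2 = (d : 𝓞 K)) :
    2⁻¹ * sgLr (sgJ d) 1 ≤ dedekindZeta_residue K := by
  have hS := (sgJ_char d hd).1
  have hlim2 : Tendsto (fun x : ℝ ↦ sgL (sgJ d) (x : ℂ)) (𝓝[>] 1) (𝓝 (sgLr (sgJ d) 1 : ℂ)) := by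
    have := sgL_real (sgJ d) 1
    rw [← this, Complex.ofReal_one]
    have h5 : ContinuousAt (sgL (sgJ d)) 1 := by
      refine (hS.diff.continuousOn).continuousAt ?_
      exact (isOpen_lt continuous_const Complex.continuous_re).mem_nhds (by simp)
    have h6 : Tendsto (fun x : ℝ ↦ (x : ℂ)) (𝓝[>] 1) (𝓝 1) := by
      have := Complex.continuous_ofReal.tendsto 1
      simpa using this.mono_left nhdsWithin_le_nhds
    exact h5.tendsto.comp h6
  have hlim1 : Tendsto (fun x : ℝ ↦ ((x : ℂ) - 1) * DirichletCharacter.LFunctionTrivChar 2 x)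
      (𝓝[>] 1) (𝓝 (2⁻¹ : ℂ)) := by
    have h7 := DirichletCharacter.LFunctionTrivChar_residue_one (N := 2)
    have h6 : Tendsto (fun x : ℝ ↦ (x : ℂ)) (𝓝[>] 1) (𝓝[≠] 1) := by
      rw [tendsto_nhdsWithin_iff]
      constructor
      · have := Complex.continuous_ofReal.tendsto 1
        simpa using this.mono_left nhdsWithin_le_nhds
      · filter_upwards [self_mem_nhdsWithin] with x hx
        have hx : (1 : ℝ) < x := hx
        simp only [Set.mem_compl_iff, Set.mem_singleton_iff]
        exact_mod_cast hx.ne'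
    have h8 := h7.comp h6
    rw [Nat.Prime.primeFactors Nat.prime_two, Finset.prod_singleton] at h8
    have e : (2 : ℂ)⁻¹ = 1 - ((2 : ℕ) : ℂ)⁻¹ := by norm_num
    rw [e]
    exact h8
  have hlim := (Complex.continuous_re.tendsto _).comp (hlim1.mul hlim2)
  have hlimK := (Complex.continuous_re.tendsto _).comp (tendsto_sub_one_mul_dedekindZeta_nhdsGT K)
  have e1 : ((2⁻¹ : ℂ) * (sgLr (sgJ d) 1 : ℂ)).re = 2⁻¹ * sgLr (sgJ d) 1 := by
    have : ((2⁻¹ : ℂ) * (sgLr (sgJ d) 1 : ℂ)) = ((2⁻¹ * sgLr (sgJ d) 1 : ℝ) : ℂ) := by push_cast; rfl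
    rw [this, Complex.ofReal_re]
  rw [e1] at hlim
  rw [Complex.ofReal_re] at hlimK
  refine le_of_tendsto_of_tendsto hlim hlimK ?_
  filter_upwards [self_mem_nhdsWithin] with x hx
  have hx : (1 : ℝ) < x := hx
  have hx' : 1 < (x : ℂ).re := by simpa using hx
  have hsum := sgc_mul (sgO_hasSum hx') (hS.X_hasSum hx')
  have hc := sg_cmp (fun n ↦ (sgX (sgJ 1) * sgX (sgJ d)) n) (fun n ↦ (sgA K n : ℝ))
    (fun n ↦ (sgF_le h2 hd hds ha n).2) x hsum.LSeriesSummable (sgA_summable K hx')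
  have e2 : LSeries (fun n ↦ (((sgX (sgJ 1) * sgX (sgJ d)) n : ℝ) : ℂ)) x = _ := hsum.LSeries_eq
  rw [e2] at hc
  have e3 : LSeries (fun n ↦ (((sgA K n : ℝ)) : ℂ)) x = dedekindZeta K x := by
    unfold dedekindZeta sgA; simp
  rw [e3] at hc
  simp only [Function.comp_apply]
  have e4 : ((x : ℂ) - 1) = ((x - 1 : ℝ) : ℂ) := by push_cast; rfl
  rw [mul_assoc, e4, Complex.re_ofReal_mul, Complex.re_ofReal_mul]
  exact mul_le_mul_of_nonneg_left hc (by linarith)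

end


section

open NumberField

theorem sg_places {K : Type} [Field K] [NumberField K] (h2 : Module.finrank ℚ K = 2)
    {d : ℤ} (hd : d < 0) {α : K} (hα : α ^ 2 = (d : K)) :
    InfinitePlace.nrRealPlaces K = 0 ∧ InfinitePlace.nrComplexPlaces K = 1 := by
  have h0 : InfinitePlace.nrRealPlaces K = 0 := by
    rw [nrRealPlaces_eq_zero_iff]
    refine ⟨fun w ↦ ?_⟩
    rw [← InfinitePlace.not_isReal_iff_isComplex]
    intro hw
    have h := congrArg (InfinitePlace.embedding_of_isReal hw) hα
    rw [map_pow, map_intCast] at h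
    have h1 : (d : ℝ) < 0 := by exact_mod_cast hd
    nlinarith [sq_nonneg (InfinitePlace.embedding_of_isReal hw α)]
  have := InfinitePlace.card_add_two_mul_card_eq_rank K
  exact ⟨h0, by omega⟩

theorem sg_det_empty {ι : Type} {_ : DecidableEq ι} {_ : Fintype ι} (M : Matrix ι ι ℝ)
    (h : IsEmpty ι) : |M.det| = 1 := by
  rw [Matrix.det_isEmpty, abs_one]

theorem sg_reg {K : Type} [Field K] [NumberField K] (h2 : Module.finrank ℚ K = 2)
    {d : ℤ} (hd : d < 0) {α : K} (hα : α ^ 2 = (d : K)) : Units.regulator K = 1 := by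
  obtain ⟨h0, h1⟩ := sg_places h2 hd hα
  have hc := InfinitePlace.card_eq_nrRealPlaces_add_nrComplexPlaces K
  rw [h0, h1] at hc
  have hsub : Subsingleton (InfinitePlace K) := Fintype.card_le_one_iff_subsingleton.1 (by omega)
  rw [Units.regulator_eq_det']
  have : IsEmpty {w : InfinitePlace K // w ≠ Units.dirichletUnitTheorem.w₀} :=
    ⟨fun ⟨w, hw⟩ ↦ hw (Subsingleton.elim _ _)⟩
  exact sg_det_empty _ this

theorem sg_disc {K : Type} [Field K] [NumberField K] (h2 : Module.finrank ℚ K = 2)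
    {d : ℤ} (hd : d < 0) (hds : Squarefree d) {a : 𝓞 K} (ha : a ^ 2 = (d : 𝓞 K)) :
    discr K = d ∨ discr K = 4 * d := by
  have hr : Module.finrank ℤ (𝓞 K) = 2 := by rw [RingOfIntegers.rank, h2]
  let b : Module.Basis (Fin 2) ℤ (𝓞 K) := Module.finBasisOfFinrankEq ℤ (𝓞 K) hr
  have hb := NumberField.discr_eq_discr K b
  let v : Fin 2 → 𝓞 K := ![1, a]
  let P : Matrix (Fin 2) (Fin 2) ℤ := Matrix.of fun i j ↦ b.repr (v i) j
  have hv : (P.map (algebraMap ℤ (𝓞 K))).mulVec b = v := by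
    funext i
    rw [Matrix.mulVec, dotProduct]
    conv_rhs => rw [← b.sum_repr (v i)]
    refine Finset.sum_congr rfl fun j _ ↦ ?_
    simp [P]
  have h1 := Algebra.discr_of_matrix_mulVec (A := ℤ) b P
  rw [hv, hb] at h1
  have htr := sg_traceZ hd ha
  have htr1 : ∀ r : ℤ, Algebra.trace ℤ (𝓞 K) (r : 𝓞 K) = 2 * r := by
    intro r
    have e1 : (r : 𝓞 K) = algebraMap ℤ (𝓞 K) r := by simp
    rw [e1, Algebra.trace_algebraMap, hr]; simp
  have h3 : Algebra.discr ℤ v = 4 * d := by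
    rw [Algebra.discr_def, Matrix.det_fin_two]
    simp only [Algebra.traceMatrix_apply, Algebra.traceForm_apply, v, Matrix.cons_val_zero,
      Matrix.cons_val_one, one_mul, mul_one, htr]
    rw [← pow_two, ha, htr1]
    have := htr1 1
    rw [Int.cast_one] at this
    rw [this]; ring
  rw [h3] at h1
  set m := P.det
  set D := discr K
  rcases Int.even_or_odd m with he | ho
  · obtain ⟨k, hk⟩ := he
    have h4 : d = k * k * D := by rw [hk] at h1; nlinarith
    have hu := hds k ⟨D, h4⟩
    left
    rcases Int.isUnit_iff.1 hu with h | h <;> rw [h] at h4 <;> linarith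
  · have hco : IsCoprime (m * m) 4 := by
      have : IsCoprime m 2 := by
        obtain ⟨k, hk⟩ := ho
        exact ⟨1, -k, by rw [hk]; ring⟩
      have h22 := IsCoprime.mul_right this this
      exact IsCoprime.mul_left h22 h22
    have h4 : m * m ∣ d := by
      apply hco.dvd_of_dvd_mul_left
      exact ⟨D, by rw [h1]; ring⟩
    have hu := hds m h4
    right
    rcases Int.isUnit_iff.1 hu with h | h <;> rw [h] at h1 <;> linarith

theorem sg_class {K : Type} [Field K] [NumberField K] (h2 : Module.finrank ℚ K = 2)
    {d : ℤ} (hd : d < 0) (hds : Squarefree d) {α : K} (hα : α ^ 2 = (d : K)) :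
    sgLr (sgJ d) 1 * Real.sqrt |(discr K : ℝ)| ≤ 4 * Real.pi * classNumber K ∧
      (d.natAbs : ℝ) ≤ |(discr K : ℝ)| ∧ |(discr K : ℝ)| ≤ 4 * (d.natAbs : ℝ) := by
  have hint : IsIntegral ℤ α := by
    refine IsIntegral.of_pow (n := 2) (by norm_num) ?_
    rw [hα]; exact isIntegral_algebraMap (R := ℤ) (x := d)
  obtain ⟨a, rfl⟩ : ∃ a : 𝓞 K, (a : K) = α := ⟨⟨α, hint⟩, rfl⟩
  have ha : a ^ 2 = (d : 𝓞 K) := by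
    apply RingOfIntegers.coe_injective
    simpa using hα
  have habs : |(d : ℝ)| = (d.natAbs : ℝ) := by rw [Nat.cast_natAbs, Int.cast_abs]
  refine ⟨?_, ?_, ?_⟩
  · have hres := sg_residue h2 hd hds ha
    obtain ⟨h0, h1⟩ := sg_places h2 hd hα
    rw [dedekindZeta_residue_def, h0, h1, sg_reg h2 hd hα] at hres
    have hw : (1 : ℝ) ≤ Units.torsionOrder K := by exact_mod_cast Units.torsionOrder_pos K
    have hs : 0 < Real.sqrt |(discr K : ℝ)| :=
      Real.sqrt_pos_of_pos <| abs_pos.mpr (Int.cast_ne_zero.mpr (discr_ne_zero K))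
    have hcl : (0 : ℝ) ≤ classNumber K := by positivity
    have hpi := Real.pi_pos
    rw [le_div_iff₀ (by positivity)] at hres
    have hL := (sgJ_char d hd).1.one_nonneg
    have h5 : 2⁻¹ * sgLr (sgJ d) 1 * Real.sqrt |(discr K : ℝ)| ≤
        2⁻¹ * sgLr (sgJ d) 1 * (Units.torsionOrder K * Real.sqrt |(discr K : ℝ)|) := by
      apply mul_le_mul_of_nonneg_left _ (by positivity)
      nlinarith
    simp only [pow_zero, pow_one, one_mul, mul_one] at hres
    nlinarith
  · rcases sg_disc h2 hd hds ha with h | h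
    · rw [h, habs]
    · rw [h]; push_cast; rw [abs_mul, habs]; simp; linarith [(Nat.cast_nonneg d.natAbs : (0 : ℝ) ≤ _)]
  · rcases sg_disc h2 hd hds ha with h | h
    · rw [h, habs]; linarith [(Nat.cast_nonneg d.natAbs : (0 : ℝ) ≤ _)]
    · rw [h]; push_cast; rw [abs_mul, habs]; simp

end


theorem siegel_class_number_lower_bound :
    ∀ ε : ℝ, 0 < ε → ∃ c : ℝ, 0 < c ∧
      ∀ (d : ℤ), d < 0 → Squarefree d →
        ∀ (K : Type) [Field K] [NumberField K],
          Module.finrank ℚ K = 2 → (∃ α : K, α ^ 2 = (d : K)) →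
            c * |(NumberField.discr K : ℝ)| ^ ((1 : ℝ) / 2 - ε) ≤ (NumberField.classNumber K : ℝ) := by
  intro ε hε
  obtain ⟨c, hc, d0, H⟩ := sg_siegel2 ε hε
  have hpi := Real.pi_pos
  set c1 : ℝ := c * (4 : ℝ) ^ (-ε) / (4 * Real.pi) with hc1
  set c2 : ℝ := 1 / (Real.sqrt (4 * (d0.natAbs : ℝ)) + 1) with hc2
  have hc1p : 0 < c1 := by positivity
  have hc2p : 0 < c2 := by positivity
  refine ⟨min c1 c2, lt_min hc1p hc2p, ?_⟩
  rintro d hd hds K _ _ h2 ⟨α, hα⟩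
  obtain ⟨h1, hlo, hhi⟩ := sg_class h2 hd hds hα
  set D : ℝ := |(NumberField.discr K : ℝ)| with hD
  set h : ℝ := (NumberField.classNumber K : ℝ) with hh
  have hh1 : 1 ≤ h := by rw [hh]; exact_mod_cast NumberField.classNumber_pos K
  have hn1 : (1 : ℝ) ≤ d.natAbs := by exact_mod_cast Int.natAbs_pos.2 hd.ne
  have hD1 : 1 ≤ D := hn1.trans hlo
  have hD0 : 0 < D := by linarith
  by_cases hdd : d = d0
  · subst hdd
    have e1 : D ^ ((1 : ℝ) / 2 - ε) ≤ Real.sqrt D := by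
      rw [Real.sqrt_eq_rpow]
      exact Real.rpow_le_rpow_of_exponent_le hD1 (by linarith)
    have e2 : Real.sqrt D ≤ Real.sqrt (4 * (d.natAbs : ℝ)) := Real.sqrt_le_sqrt hhi
    calc min c1 c2 * D ^ ((1 : ℝ) / 2 - ε) ≤ c2 * (Real.sqrt (4 * (d.natAbs : ℝ)) + 1) := by
          refine mul_le_mul (min_le_right _ _) (by linarith) (by positivity) hc2p.le
      _ = 1 := by rw [hc2]; field_simp
      _ ≤ h := hh1
  · have h3 := H d hd hds hdd
    have e1 : (4 : ℝ) ^ (-ε) * D ^ (-ε) ≤ ((4 * d.natAbs : ℕ) : ℝ) ^ (-ε) := by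
      rw [← Real.mul_rpow (by norm_num) hD0.le]
      refine Real.rpow_le_rpow_of_nonpos (by push_cast; linarith) ?_ (by linarith)
      push_cast; linarith
    have e2 : D ^ ((1 : ℝ) / 2 - ε) = D ^ (-ε) * Real.sqrt D := by
      rw [Real.sqrt_eq_rpow, ← Real.rpow_add hD0]; congr 1; ring
    calc min c1 c2 * D ^ ((1 : ℝ) / 2 - ε) ≤ c1 * D ^ ((1 : ℝ) / 2 - ε) :=
          mul_le_mul_of_nonneg_right (min_le_left _ _) (by positivity)
      _ = (c * ((4 : ℝ) ^ (-ε) * D ^ (-ε))) * Real.sqrt D / (4 * Real.pi) := by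
          rw [e2, hc1]; ring
      _ ≤ sgLr (sgJ d) 1 * Real.sqrt D / (4 * Real.pi) := by
          refine div_le_div_of_nonneg_right ?_ (by positivity)
          refine mul_le_mul_of_nonneg_right ?_ (Real.sqrt_nonneg _)
          exact (mul_le_mul_of_nonneg_left e1 hc.le).trans h3
      _ ≤ h := by
          rw [div_le_iff₀ (by positivity)]; linarith
end

section
/- Let d < 0 be a squarefree integer, let K = ℚ(√d) with discriminant D = disc(K), and let t be the number of distinct rational primes dividing D. Then 2^{t−1} divides the class number of K. -/
open NumberField

lemma exP (K : Type) [Field K] [NumberField K] (hdeg : Module.finrank ℚ K = 2) (p : ℕ) (hp : p.Prime)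
    (h : (p:ℤ) ∣ discr K) : ∃ P : Ideal (𝓞 K), P ^ 2 = Ideal.span {(p : 𝓞 K)} := by
  have hpi : Prime (p:ℤ) := Nat.prime_iff_prime_int.mp hp
  have h1 := mt (not_dvd_discr_iff_forall_mem K (𝓞 K) hpi).2 (not_not.2 h)
  push Not at h1
  obtain ⟨P, hP, hpP, hun⟩ := h1
  have hle : Ideal.map (algebraMap ℤ (𝓞 K)) (Ideal.span {(p:ℤ)}) ≤ P := by
    rw [Ideal.map_span, Ideal.span_le]; simpa using hpP
  have hunder : P.LiesOver (Ideal.span {(p:ℤ)}) :=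
    (Ideal.liesOver_span_iff hP.ne_top hpi).mpr (by simpa using hpP)
  have hpp : (Ideal.span {(p:ℤ)}).IsPrime := (Ideal.span_singleton_prime hpi.ne_zero).2 hpi
  have hpm : (Ideal.span {(p:ℤ)}).IsMaximal := hpp.isMaximal (by simp [hp.ne_zero])
  have hP0 : P ≠ ⊥ := by
    rintro rfl
    simp [hp.ne_zero] at hpP
  have hle2 : Ideal.map (algebraMap ℤ (𝓞 K)) (Ideal.span {(p:ℤ)}) ≤ P ^ 2 := by
    rw [← Ideal.ramificationIdx'_ne_one_iff hle]
    intro h1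
    rw [Ideal.IsDedekindDomain.ramificationIdx'_eq_one_iff hP0 hle] at h1
    apply hun
    let := Localization.AtPrime.algebraOfLiesOver (Ideal.span {(p:ℤ)}) P
    rw [Algebra.isUnramifiedAt_iff_map_eq ℤ (Ideal.span {(p:ℤ)}) P]
    refine ⟨?_, h1⟩
    have : Finite (ℤ ⧸ (Ideal.span {(p:ℤ)})) := by
      have := NeZero.mk hp.ne_zero
      exact Finite.of_equiv (ZMod p) (Int.quotientSpanNatEquivZMod p).symm.toEquiv
    have : Finite (Ideal.span {(p:ℤ)}).ResidueField := inferInstance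
    exact Algebra.IsAlgebraic.isSeparable_of_perfectField
  rw [Ideal.map_span, ← Ideal.dvd_iff_le] at hle2
  obtain ⟨Q, hQ⟩ := hle2
  simp at hQ
  have hn := congrArg Ideal.absNorm hQ
  rw [Ideal.absNorm_span_natCast, map_mul, map_pow, RingOfIntegers.rank, hdeg] at hn
  have h3 : Ideal.absNorm P ∣ p := (Nat.pow_dvd_pow_iff two_ne_zero).1 ⟨_, hn⟩
  have h4 : Ideal.absNorm P = p := (hp.eq_one_or_self_of_dvd _ h3).resolve_left (by
    rw [Ideal.absNorm_eq_one_iff]; exact hP.ne_top)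
  have h5 : Ideal.absNorm Q = 1 := by
    rw [h4] at hn
    have := hp.pos
    exact Nat.eq_of_mul_eq_mul_left (pow_pos this 2) (by rw [← hn, mul_one])
  rw [Ideal.absNorm_eq_one_iff] at h5
  exact ⟨P, by rw [hQ, h5, Ideal.mul_top]⟩

lemma gen_repr (d : ℤ) (hd : d < 0) 
    (K : Type) [Field K] [NumberField K]
    (hdeg : Module.finrank ℚ K = 2) (α : K) (hα : α ^ 2 = (d : K)) (x : K) :
    ∃ r s : ℚ, x = r + s * α := by
  have hirr : ∀ q : ℚ, (q:K) ≠ α := by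
    rintro q rfl
    have : q^2 = d := by exact_mod_cast hα
    have : (d:ℚ) < 0 := by exact_mod_cast hd
    nlinarith [sq_nonneg q]
  have li : LinearIndependent ℚ ![(1:K), α] := by
    rw [LinearIndependent.pair_iff' one_ne_zero]
    intro a
    simpa [Algebra.smul_def] using hirr a
  have := li.span_eq_top_of_card_eq_finrank (by simp [hdeg])
  have hx : x ∈ Submodule.span ℚ (Set.range ![(1:K), α]) := by rw [this]; trivial
  simp only [Matrix.range_cons, Matrix.range_empty, Set.union_empty, Set.singleton_union] at hx
  rw [Submodule.mem_span_pair] at hx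
  obtain ⟨r, s, h⟩ := hx
  exact ⟨r, s, by rw [← h]; simp [Algebra.smul_def]⟩

lemma sqK (d : ℤ) (hd : d < 0) 
    (K : Type) [Field K] [NumberField K]
    (hdeg : Module.finrank ℚ K = 2) (α : K) (hα : α ^ 2 = (d : K)) (x : K) (n : ℕ) (hn : 0 < n)
    (hx : x ^ 2 = n) : IsSquare n := by
  obtain ⟨r, s, rfl⟩ := gen_repr d hd K hdeg α hα x
  have hirr : ∀ q : ℚ, (q:K) ≠ α := by
    rintro q rfl
    have : q^2 = d := by exact_mod_cast hα
    have : (d:ℚ) < 0 := by exact_mod_cast hd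
    nlinarith [sq_nonneg q]
  have hdQ : (d:ℚ) < 0 := by exact_mod_cast hd
  have hnQ : (0:ℚ) < n := by exact_mod_cast hn
  have e : ((n - r^2 - s^2*d : ℚ) : K) = ((2*r*s : ℚ):K) * α := by
    push_cast
    rw [← hα, ← hx]; ring
  have hrs : 2*r*s = 0 := by
    by_contra h0
    apply hirr ((n - r^2 - s^2*d)/(2*r*s))
    have h0' : ((2*r*s : ℚ):K) ≠ 0 := by exact_mod_cast h0
    rw [Rat.cast_div, e]; field_simp
  rw [hrs] at e
  have e' : n - r^2 - s^2*d = 0 := by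
    have : ((n - r^2 - s^2*d : ℚ) : K) = 0 := by rw [e]; simp
    exact_mod_cast this
  have hs : s = 0 := by
    rcases mul_eq_zero.1 hrs with h | h
    · have : r = 0 := by linarith
      subst this
      nlinarith [sq_nonneg s]
    · exact h
  subst hs
  rw [← Rat.isSquare_natCast_iff]
  exact ⟨r, by linarith⟩

lemma unitsCyc (d : ℤ) (hd : d < 0) 
    (K : Type) [Field K] [NumberField K]
    (hdeg : Module.finrank ℚ K = 2) (α : K) (hα : α ^ 2 = (d : K)) : 
    ∃ ζ : (𝓞 K)ˣ, ∀ u : (𝓞 K)ˣ, ∃ k : ℕ, u = ζ ^ k := by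
  have hre : InfinitePlace.nrRealPlaces K = 0 := by
    rw [nrRealPlaces_eq_zero_iff, isTotallyComplex_iff]
    intro v
    rw [← InfinitePlace.not_isReal_iff_isComplex]
    intro hv
    have := congrArg (InfinitePlace.embedding_of_isReal hv) hα
    rw [map_pow, map_intCast] at this
    have : (d:ℝ) < 0 := by exact_mod_cast hd
    nlinarith [sq_nonneg (InfinitePlace.embedding_of_isReal hv α)]
  have hc := InfinitePlace.card_add_two_mul_card_eq_rank K
  have hr : Units.rank K = 0 := by
    rw [Units.rank, InfinitePlace.card_eq_nrRealPlaces_add_nrComplexPlaces]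
    omega
  classical
  obtain ⟨ζ, hζ⟩ := IsCyclic.exists_generator (α := Units.torsion K)
  refine ⟨ζ, fun u => ?_⟩
  obtain ⟨⟨x, e⟩, hxu, -⟩ := Units.exist_unique_eq_mul_prod K u
  have : IsEmpty (Fin (Units.rank K)) := by rw [hr]; infer_instance
  simp at hxu
  have := hζ x
  rw [mem_zpowers_iff_mem_range_orderOf] at this
  simp at this
  obtain ⟨k, hk, h⟩ := this
  exact ⟨k, by rw [hxu, ← h]; simp⟩

noncomputable def prodHom {ι G : Type} [Fintype ι] [CommGroup G] (c : ι → G) (hc : ∀ i, c i ^ 2 = 1) :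
    (ι → Multiplicative (ZMod 2)) →* G where
  toFun f := ∏ i, c i ^ (f i).toAdd.val
  map_one' := by simp
  map_mul' f g := by
    rw [← Finset.prod_mul_distrib]
    refine Finset.prod_congr rfl fun i _ => ?_
    rw [← pow_add, Pi.mul_apply, toAdd_mul, ZMod.val_add, ← pow_eq_pow_mod _ (hc i)]

lemma count {ι G : Type} [Fintype ι] [CommGroup G] [Finite G] 
    (φ : (ι → Multiplicative (ZMod 2)) →* G) (b : φ.ker → Bool) (hb : Function.Injective b) :
    2 ^ (Fintype.card ι - 1) ∣ Nat.card G := by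
  have h1 : Nat.card φ.ker ≤ 2 := by
    simpa using Nat.card_le_card_of_injective b hb
  have h2 : Nat.card φ.ker * Nat.card φ.range = 2 ^ Fintype.card ι := by
    rw [← Subgroup.index_ker, Subgroup.card_mul_index, Nat.card_fun]
    have : Nat.card (Multiplicative (ZMod 2)) = 2 := Nat.card_zmod 2
    rw [this, Nat.card_eq_fintype_card]
  have h3 : 0 < Nat.card φ.ker := Nat.card_pos
  refine dvd_trans ?_ (Subgroup.card_subgroup_dvd_card φ.range)
  have : Nat.card φ.ker = 1 ∨ Nat.card φ.ker = 2 := by omega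
  rcases this with h | h
  · rw [h, one_mul] at h2
    rw [h2]; exact pow_dvd_pow _ (Nat.sub_le _ _)
  · rw [h] at h2
    rcases hc : Fintype.card ι with _ | m
    · simp
    · rw [hc, pow_succ'] at h2
      have := Nat.eq_of_mul_eq_mul_left two_pos h2
      rw [this]; simp

lemma eq_of_sq (s : Finset ℕ) (hs : ∀ p ∈ s, p.Prime) (f g : s → Multiplicative (ZMod 2))
    (h : IsSquare ((∏ i, i.1 ^ (f i).toAdd.val) * ∏ i, i.1 ^ (g i).toAdd.val)) : f = g := by
  classical
  rw [← Finset.prod_mul_distrib] at h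
  simp_rw [← pow_add] at h
  obtain ⟨m, hm⟩ := h
  funext i
  have h1 := congrArg (fun n => n.factorization i.1) hm
  have h0 : ∀ j : s, j.1 ≠ 0 := fun j => (hs j j.2).ne_zero
  have hm0 : m ≠ 0 := by
    rintro rfl
    rw [mul_zero, Finset.prod_eq_zero_iff] at hm
    obtain ⟨j, -, hj⟩ := hm
    exact h0 j (eq_zero_of_pow_eq_zero hj)
  beta_reduce at h1
  rw [Nat.factorization_mul hm0 hm0, Nat.factorization_prod (fun j _ => pow_ne_zero _ (h0 j)),
    Finsupp.finsetSum_apply, Finset.sum_eq_single i] at h1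
  · rw [Nat.factorization_pow, Finsupp.smul_apply, (hs i i.2).factorization_self] at h1
    simp at h1
    have a := ZMod.val_lt (f i).toAdd
    have b := ZMod.val_lt (g i).toAdd
    apply Multiplicative.toAdd.injective
    apply ZMod.val_injective
    omega
  · intro j _ hj
    rw [Nat.factorization_pow, (hs j j.2).factorization, Finsupp.smul_apply, Finsupp.single_apply,
      if_neg (fun h => hj (Subtype.ext h))]
    simp
  · simp

lemma ker_gen {ι R : Type} [Fintype ι] [CommRing R] [IsDedekindDomain R]
    (p : ι → ℕ) (P : ι → nonZeroDivisors (Ideal R))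
    (hP : ∀ i, (P i : Ideal R) ^ 2 = Ideal.span {(p i : R)}) (e : ι → ℕ)
    (hf : ∏ i, ClassGroup.mk0 (P i) ^ e i = 1) :
    ∃ a : R, Ideal.span {a ^ 2} = Ideal.span {((∏ i, p i ^ e i : ℕ) : R)} := by
  simp_rw [← map_pow, ← map_prod] at hf
  obtain ⟨a, ha⟩ := (ClassGroup.mk0_eq_one_iff (∏ i, P i ^ e i).2).1 hf
  refine ⟨a, ?_⟩
  rw [← Ideal.span_singleton_pow]
  change _ = Ideal.span {a} at ha
  rw [← ha]
  push_cast
  rw [← Ideal.prod_span_singleton, ← Finset.prod_pow]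
  refine Finset.prod_congr rfl fun i _ => ?_
  rw [← pow_mul, mul_comm, pow_mul, ← Ideal.span_singleton_pow, hP]

lemma sq_one {R : Type} [CommRing R] [IsDedekindDomain R]
    (p : ℕ) (P : nonZeroDivisors (Ideal R)) (hP : (P : Ideal R) ^ 2 = Ideal.span {(p : R)}) :
    ClassGroup.mk0 P ^ 2 = 1 := by
  have h : P ^ 2 = ⟨Ideal.span {(p : R)}, by rw [← hP]; exact pow_mem P.2 2⟩ := Subtype.ext hP
  rw [← map_pow, h]
  rw [ClassGroup.mk0_eq_one_iff]
  exact ⟨(p : R), rfl⟩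

theorem genus_theory_two_pow_divides_class_number
    (d : ℤ) (hd : d < 0) (hsf : Squarefree d)
    (K : Type) [Field K] [NumberField K]
    (hdeg : Module.finrank ℚ K = 2)
    (hsqrt : ∃ α : K, α ^ 2 = (d : K))
    (D : ℤ) (hD : D = NumberField.discr K)
    (t : ℕ) (ht : t = D.natAbs.primeFactors.card) :
    2 ^ (t - 1) ∣ NumberField.classNumber K := by
  obtain ⟨α, hα⟩ := hsqrt
  subst hD ht
  generalize hs : (discr K).natAbs.primeFactors = s
  have hsp : ∀ p ∈ s, p.Prime := fun p hp => Nat.prime_of_mem_primeFactors (hs ▸ hp)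
  have hP : ∀ p : s, ∃ P : Ideal (𝓞 K), P ^ 2 = Ideal.span {(p.1 : 𝓞 K)} := fun p =>
    exP K hdeg p (hsp p p.2) (Int.natCast_dvd.2 (Nat.dvd_of_mem_primeFactors (hs ▸ p.2)))
  choose P hP using hP
  have hP0 : ∀ p : s, P p ∈ nonZeroDivisors (Ideal (𝓞 K)) := fun p => by
    rw [mem_nonZeroDivisors_iff_ne_zero]
    intro h
    have := hP p
    rw [h, zero_pow two_ne_zero, eq_comm, Ideal.zero_eq_bot, Ideal.span_singleton_eq_bot] at this
    exact (hsp p p.2).ne_zero (by exact_mod_cast this)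
  obtain ⟨ζ, hζ⟩ := unitsCyc d hd K hdeg α hα
  let P' : s → nonZeroDivisors (Ideal (𝓞 K)) := fun p => ⟨P p, hP0 p⟩
  have hc : ∀ p : s, (ClassGroup.mk0 (P' p)) ^ 2 = 1 := fun p =>
    sq_one p.1 (P' p) (hP p)
  let φ := prodHom (fun p : s => ClassGroup.mk0 (P' p)) hc
  have key : ∀ f : φ.ker, ∃ k : ℕ, ∃ a : 𝓞 K,
      a ^ 2 = ((∏ i, i.1 ^ (f.1 i).toAdd.val : ℕ) : 𝓞 K) * (ζ ^ k : (𝓞 K)ˣ) := by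
    intro f
    obtain ⟨a, ha2⟩ := ker_gen (fun p : s => (p.1 : ℕ)) P' hP (fun i => (f.1 i).toAdd.val) f.2
    rw [Ideal.span_singleton_eq_span_singleton] at ha2
    obtain ⟨u, hu⟩ := ha2.symm
    obtain ⟨k, hk⟩ := hζ u
    refine ⟨k, a, ?_⟩
    rw [← hk]; exact hu.symm
  choose k a ha using key
  have := count φ (fun f => decide (Even (k f))) ?_
  · simpa [classNumber, Nat.card_eq_fintype_card] using this
  intro f g hfg
  simp only [decide_eq_decide] at hfg
  obtain ⟨m, hm⟩ : Even (k f + k g) := by rw [Nat.even_add]; exact hfg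
  apply Subtype.ext
  apply eq_of_sq s hsp
  apply sqK d hd K hdeg α hα ((a f * a g * ((ζ⁻¹) ^ m : (𝓞 K)ˣ) : 𝓞 K) : K)
  · exact Nat.pos_of_ne_zero (mul_ne_zero
      (Finset.prod_ne_zero_iff.2 fun i _ => pow_ne_zero _ (hsp i i.2).ne_zero)
      (Finset.prod_ne_zero_iff.2 fun i _ => pow_ne_zero _ (hsp i i.2).ne_zero))
  · have hz : ((ζ ^ k f : (𝓞 K)ˣ) : 𝓞 K) * (ζ ^ k g : (𝓞 K)ˣ) * ((ζ⁻¹) ^ m : (𝓞 K)ˣ) ^ 2 = 1 := by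
      rw [← Units.val_mul, ← Units.val_pow_eq_pow_val, ← Units.val_mul, ← pow_add, hm, ← two_mul,
        ← pow_mul, mul_comm m 2, inv_pow, mul_inv_cancel, Units.val_one]
    have : (a f * a g * ((ζ⁻¹) ^ m : (𝓞 K)ˣ) : 𝓞 K) ^ 2 =
      (((∏ i, i.1 ^ (f.1 i).toAdd.val) * ∏ i, i.1 ^ (g.1 i).toAdd.val : ℕ) : 𝓞 K) := by
      rw [mul_pow, mul_pow, ha, ha, Nat.cast_mul]
      linear_combination (((∏ i, i.1 ^ (f.1 i).toAdd.val : ℕ) : 𝓞 K) * ((∏ i, i.1 ^ (g.1 i).toAdd.val : ℕ) : 𝓞 K)) * hz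
    rw [← map_pow, this, map_natCast]
end
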